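/- arXiv:hep-th/0101063 — 5 statements merged into one kernel-verified Lean document; each statement's English description precedes it below -/
import Mathlib

section
/- Let f and g each be Hardy class from below of order 2 with Schwartz restrictions to the real axis, and let P be a polynomial with complex coefficients. Then the product z ↦ f(z) P(z) g(z) is Hardy class from below of order 1, and for the arcs C_r = {−r e^{iθ} : 1/r ≤ θ ≤ π − 1/r} the arc-length integral r ∫_{1/r}^{π−1/r} |f(−r e^{iθ}) P(−r e^{iθ}) g(−r e^{iθ})| dθ tends to 0 as r → ∞. -/
open MeasureTheory Filter

/-- `f : ℂ → ℂ` is Hardy class from below of order `p`: analytic on the open lower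
half-plane, continuous on the closed lower half-plane, and the `L^p` norms of the
horizontal sections `x ↦ f (x + iy)`, `y < 0`, are uniformly bounded. -/
def HardyBelow (p : ℝ) (f : ℂ → ℂ) : Prop :=
  DifferentiableOn ℂ f {z : ℂ | z.im < 0} ∧
  ContinuousOn f {z : ℂ | z.im ≤ 0} ∧
  ∃ M : ℝ, ∀ y : ℝ, y < 0 →
    Integrable (fun x : ℝ => ‖f (↑x + ↑y * Complex.I)‖ ^ p) ∧
    ∫ x : ℝ, ‖f (↑x + ↑y * Complex.I)‖ ^ p ≤ M

/-- A holomorphic function on the lower half-plane has a primitive near every compact subset. -/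
theorem exists_primitive_lowerHalfPlane_of_isCompact {F : ℂ → ℂ}
    (hF : DifferentiableOn ℂ F {z : ℂ | z.im < 0}) {K : Set ℂ} (hK : IsCompact K)
    (hKim : K ⊆ {z : ℂ | z.im < 0}) :
    ∃ G : ℂ → ℂ, ∀ z ∈ K, HasDerivAt G (F z) z := by
  obtain ⟨T, hT, hKT⟩ : ∃ T : ℝ, 0 < T ∧ K ⊆ Metric.ball (-(T * Complex.I)) T := by
    obtain ⟨A, hA⟩ := hK.exists_bound_of_continuousOn
      (f := fun z : ℂ => ‖z‖ ^ 2 / (-z.im)) <| by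
        refine ContinuousOn.div (by fun_prop) (by fun_prop) fun z hz => ?_
        have : z.im < 0 := hKim hz
        linarith
    refine ⟨max A 1, by positivity, fun z hz => ?_⟩
    set T := max A 1
    have hT : 0 < T := by positivity
    have him : z.im < 0 := hKim hz
    have h1 : ‖z‖ ^ 2 / (-z.im) ≤ T := (le_abs_self _).trans ((hA z hz).trans (le_max_left _ _))
    rw [div_le_iff₀ (by linarith), ← Complex.normSq_eq_norm_sq, Complex.normSq_apply] at h1
    rw [Metric.mem_ball, Complex.dist_eq]
    refine lt_of_pow_lt_pow_left₀ 2 hT.le ?_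
    rw [← Complex.normSq_eq_norm_sq, Complex.normSq_apply]
    simp
    nlinarith [mul_neg_of_pos_of_neg hT him]
  have hsub : Metric.ball (-(T * Complex.I)) T ⊆ {z : ℂ | z.im < 0} := by
    intro z hz
    have h := (Complex.abs_im_le_norm _).trans_lt (by simpa [Complex.dist_eq] using hz)
    simp at h
    have := (abs_lt.1 h).2
    simp only [Set.mem_ofPred_eq]
    linarith
  obtain ⟨G, hG⟩ := (hF.mono hsub).isExactOn_ball
  exact ⟨G, fun z hz => hG z (hKT hz)⟩

/-- Cauchy estimate for the horizontal increments of a function whose horizontal sections are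
bounded in `L¹`. -/
theorem norm_sub_le_of_integral_norm_le {F : ℂ → ℂ} {M : ℝ}
    (hF : DifferentiableOn ℂ F {z : ℂ | z.im < 0})
    (hM : ∀ y : ℝ, y < 0 → Integrable (fun x : ℝ => ‖F (x + y * Complex.I)‖) ∧
      ∫ x : ℝ, ‖F (x + y * Complex.I)‖ ≤ M)
    {z : ℂ} (hz : z.im < 0) (s : ℝ) :
    ‖F (z + s) - F z‖ ≤ M / (-z.im / 2) := by
  set R := -z.im / 2 with hR
  have hR0 : 0 < R := by simp [hR]; exact hz
  have him : ∀ w ∈ Metric.closedBall z R, w.im < 0 := by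
    intro w hw
    have h := (Complex.abs_im_le_norm _).trans (by simpa [Complex.dist_eq] using hw)
    have := (abs_le.1 h).2
    simp only [Complex.sub_im] at this
    linarith
  set K : Set ℂ := (fun p : ℂ × ℝ => p.1 + p.2) '' (Metric.closedBall z R ×ˢ Set.uIcc 0 s)
  have hK : IsCompact K :=
    ((isCompact_closedBall z R).prod isCompact_uIcc).image (by fun_prop)
  obtain ⟨G, hG⟩ := exists_primitive_lowerHalfPlane_of_isCompact hF hK <| by
    rintro _ ⟨⟨w, t⟩, ⟨hw, -⟩, rfl⟩
    simpa using him w hw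
  have hGd : ∀ w ∈ Metric.closedBall z R, ∀ t ∈ Set.uIcc 0 s,
      HasDerivAt G (F (w + t)) (w + t) := fun w hw t ht => hG _ ⟨(w, t), ⟨hw, ht⟩, rfl⟩
  have hder : ∀ w ∈ Metric.closedBall z R,
      HasDerivAt (fun w => G (w + s) - G w) (F (w + s) - F w) w := by
    intro w hw
    have h0 := hGd w hw 0 Set.left_mem_uIcc
    simp only [Complex.ofReal_zero, add_zero] at h0
    exact ((hGd w hw s Set.right_mem_uIcc).comp_add_const w (s : ℂ)).sub h0
  have hbound : ∀ w ∈ Metric.closedBall z R, ‖G (w + s) - G w‖ ≤ M := by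
    intro w hw
    have hcont : Continuous fun t : ℝ => F (w + t) := by
      refine hF.continuousOn.comp_continuous (by fun_prop) fun t => ?_
      simpa using him w hw
    have hFTC : ∫ t in (0 : ℝ)..s, F (w + t) = G (w + s) - G w := by
      have := intervalIntegral.integral_eq_sub_of_hasDerivAt (f := fun t : ℝ => G (w + t))
        (f' := fun t : ℝ => F (w + t)) (a := 0) (b := s)
        (fun t ht => HasDerivAt.comp_ofReal (e := fun u : ℂ => G (w + u))
          ((hGd w hw t ht).comp_const_add w (t : ℂ)))
        (hcont.intervalIntegrable _ _)
      simpa using this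
    obtain ⟨hint, hle⟩ := hM w.im (him w hw)
    have heq : (fun t : ℝ => ‖F (w + t)‖) =
        fun t : ℝ => (fun x : ℝ => ‖F (x + w.im * Complex.I)‖) (t + w.re) := by
      funext t
      congr 2
      apply Complex.ext <;> simp [add_comm]
    have hint' : Integrable fun t : ℝ => ‖F (w + t)‖ := by
      rw [heq]; exact hint.comp_add_right w.re
    have hle' : ∫ t : ℝ, ‖F (w + t)‖ ≤ M := by
      rw [heq, integral_add_right_eq_self (fun x : ℝ => ‖F (x + w.im * Complex.I)‖)]
      exact hle
    rw [← hFTC]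
    refine intervalIntegral.norm_integral_le_integral_norm_uIoc.trans (le_trans ?_ hle')
    exact setIntegral_le_integral hint' (Eventually.of_forall fun t => norm_nonneg _)
  have hz' : z ∈ Metric.closedBall z R := Metric.mem_closedBall_self hR0.le
  rw [← (hder z hz').deriv]
  refine Complex.norm_deriv_le_of_forall_mem_sphere_norm_le hR0 ?_
    fun w hw => hbound w (Metric.sphere_subset_closedBall hw)
  refine DifferentiableOn.diffContOnCl fun w hw => ?_
  rw [closure_ball z hR0.ne'] at hw
  exact (hder w hw).differentiableAt.differentiableWithinAt

/-- Interior estimate for functions whose horizontal sections are bounded in `L¹`. -/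
theorem norm_le_of_integral_norm_le {F : ℂ → ℂ} {M : ℝ}
    (hF : DifferentiableOn ℂ F {z : ℂ | z.im < 0})
    (hM : ∀ y : ℝ, y < 0 → Integrable (fun x : ℝ => ‖F (x + y * Complex.I)‖) ∧
      ∫ x : ℝ, ‖F (x + y * Complex.I)‖ ≤ M)
    {z : ℂ} (hz : z.im < 0) : ‖F z‖ ≤ M / (-z.im / 2) := by
  refine le_of_forall_pos_le_add fun ε hε => ?_
  obtain ⟨x, hx⟩ : ∃ x : ℝ, ‖F (x + z.im * Complex.I)‖ ≤ ε := by
    by_contra! h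
    have hc : Integrable (fun _ : ℝ => ε) := (hM z.im hz).1.mono' (by fun_prop)
      (Eventually.of_forall fun x => by rw [Real.norm_of_nonneg hε.le]; exact (h x).le)
    rw [MeasureTheory.integrable_const_iff] at hc
    rcases hc with hc | hc
    · exact hε.ne' hc
    · simpa using hc.measure_univ_lt_top
  have h := norm_sub_le_of_integral_norm_le hF hM hz (x - z.re)
  have hzx : z + ((x - z.re : ℝ) : ℂ) = x + z.im * Complex.I := by
    apply Complex.ext <;> simp
  rw [hzx] at h
  have := norm_sub_norm_le (F z) (F (x + z.im * Complex.I))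
  rw [norm_sub_rev] at this
  linarith

/-- A function continuous on the closed lower half-plane which blows up at most like `1 / |im z|`
inside and is bounded on the real axis is bounded. -/
theorem norm_le_of_norm_le_div_im {F : ℂ → ℂ} {A B : ℝ}
    (hF : DifferentiableOn ℂ F {z : ℂ | z.im < 0}) (hc : ContinuousOn F {z : ℂ | z.im ≤ 0})
    (hA : ∀ z : ℂ, z.im < 0 → ‖F z‖ ≤ A / (-z.im)) (hB : ∀ x : ℝ, ‖F x‖ ≤ B)
    {z : ℂ} (hz : z.im ≤ 0) : ‖F z‖ ≤ 9 * A + 9 * B := by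
  have hA0 : 0 ≤ A := by
    have := (norm_nonneg _).trans (hA (-Complex.I) (by simp))
    simpa using this
  have hB0 : 0 ≤ B := (norm_nonneg _).trans (hB 0)
  rcases le_or_gt z.im (-1) with h1 | h1
  · refine (hA z (by linarith)).trans ?_
    rw [div_le_iff₀ (by linarith)]
    nlinarith
  set x₀ := z.re
  set h : ℂ → ℂ := fun w => F w * ((w - x₀) ^ 2 - 1)
  have hne : (x₀ - 1 : ℝ) ≠ x₀ + 1 := by linarith
  have hlt : (x₀ - 1 : ℝ) < x₀ + 1 := by linarith
  have hcl : closure (Set.Ioo (x₀ - 1) (x₀ + 1) ×ℂ Set.Ioo (-1 : ℝ) 0) =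
      Set.Icc (x₀ - 1) (x₀ + 1) ×ℂ Set.Icc (-1 : ℝ) 0 := by
    rw [Complex.closure_reProdIm, closure_Ioo hne, closure_Ioo (by norm_num)]
  have hh : ‖h z‖ ≤ 9 * A + 9 * B := by
    refine Complex.norm_le_of_forall_mem_frontier_norm_le
      (U := Set.Ioo (x₀ - 1) (x₀ + 1) ×ℂ Set.Ioo (-1 : ℝ) 0)
      ((Metric.isBounded_Ioo _ _).reProdIm (Metric.isBounded_Ioo _ _)) ⟨?_, ?_⟩ ?_ ?_
    · exact (hF.mono fun w hw => hw.2.2).mul (by fun_prop)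
    · rw [hcl]
      exact (hc.mono fun w hw => hw.2.2).mul (by fun_prop)
    · intro w hw
      have hfac : ‖h w‖ = ‖F w‖ * (‖w - x₀ - 1‖ * ‖w - x₀ + 1‖) := by
        simp only [h]
        rw [← norm_mul, ← norm_mul]
        congr 1; ring
      rw [hfac]
      rw [Complex.frontier_reProdIm, closure_Ioo hne, closure_Ioo (by norm_num),
        frontier_Ioo hlt, frontier_Ioo (by norm_num)] at hw
      obtain ⟨hre, him⟩ : w.re ∈ Set.Icc (x₀ - 1) (x₀ + 1) ∧ w.im ∈ Set.Icc (-1 : ℝ) 0 := by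
        rcases hw with ⟨hw1, hw2⟩ | ⟨hw1, hw2⟩
        · refine ⟨hw1, ?_⟩
          rcases hw2 with hw2 | hw2 <;> rw [hw2] <;> norm_num
        · refine ⟨?_, hw2⟩
          rcases hw1 with hw1 | hw1 <;> rw [hw1] <;> constructor <;> linarith
      have hL : ‖w - x₀ - 1‖ ≤ 2 - w.im := by
        refine (Complex.norm_le_abs_re_add_abs_im _).trans ?_
        simp only [Complex.sub_re, Complex.sub_im, Complex.ofReal_re, Complex.ofReal_im,
          Complex.one_re, Complex.one_im, sub_zero, abs_of_nonpos him.2]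
        have : |w.re - x₀ - 1| ≤ 2 := abs_le.2 ⟨by linarith [hre.1], by linarith [hre.2]⟩
        linarith
      have hR : ‖w - x₀ + 1‖ ≤ 2 - w.im := by
        refine (Complex.norm_le_abs_re_add_abs_im _).trans ?_
        simp only [Complex.sub_re, Complex.sub_im, Complex.ofReal_re, Complex.ofReal_im,
          Complex.one_re, Complex.one_im, Complex.add_re, Complex.add_im, sub_zero, add_zero,
          abs_of_nonpos him.2]
        have : |w.re - x₀ + 1| ≤ 2 := abs_le.2 ⟨by linarith [hre.1], by linarith [hre.2]⟩
        linarith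
      have hL3 : ‖w - x₀ - 1‖ ≤ 3 := by linarith [him.1]
      have hR3 : ‖w - x₀ + 1‖ ≤ 3 := by linarith [him.1]
      have hLR : ‖w - x₀ - 1‖ * ‖w - x₀ + 1‖ ≤ 3 * 3 := by gcongr
      have hside : w.im < 0 → ‖w - x₀ - 1‖ * ‖w - x₀ + 1‖ ≤ 9 * (-w.im) →
          ‖F w‖ * (‖w - x₀ - 1‖ * ‖w - x₀ + 1‖) ≤ 9 * A + 9 * B := by
        intro hw0 hle
        calc ‖F w‖ * (‖w - x₀ - 1‖ * ‖w - x₀ + 1‖) ≤ A / (-w.im) * (9 * (-w.im)) := by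
              exact mul_le_mul (hA w hw0) hle (by positivity) ((norm_nonneg _).trans (hA w hw0))
          _ = 9 * A := by
              have : w.im ≠ 0 := hw0.ne
              field_simp
          _ ≤ 9 * A + 9 * B := by linarith
      rcases him.2.eq_or_lt with hw0 | hw0
      · have hwB : ‖F w‖ ≤ B := by
          have : w = (w.re : ℂ) := Complex.ext (by simp) (by simp [hw0])
          rw [this]; exact hB _
        calc ‖F w‖ * (‖w - x₀ - 1‖ * ‖w - x₀ + 1‖) ≤ B * (3 * 3) := by gcongr
          _ ≤ 9 * A + 9 * B := by linarith
      · rcases hw with ⟨-, hw | hw⟩ | ⟨hw | hw, -⟩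
        · refine hside hw0 (hLR.trans ?_)
          rw [hw]; norm_num
        · exact absurd hw hw0.ne
        · have : w - x₀ + 1 = w.im * Complex.I := by apply Complex.ext <;> simp [hw]
          refine hside hw0 ?_
          rw [this, norm_mul, Complex.norm_I, mul_one, Complex.norm_real,
            Real.norm_of_nonpos hw0.le]
          nlinarith
        · have : w - x₀ - 1 = w.im * Complex.I := by
            apply Complex.ext <;> simp [Set.mem_singleton_iff.1 hw]
          refine hside hw0 ?_
          rw [this, norm_mul, Complex.norm_I, mul_one, Complex.norm_real,
            Real.norm_of_nonpos hw0.le]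
          nlinarith
    · rw [hcl]
      exact ⟨⟨by simp [x₀], by simp [x₀]⟩, h1.le, hz⟩
  refine le_trans ?_ hh
  have hz2 : ((z - x₀) ^ 2 - 1 : ℂ) = ((-(z.im ^ 2 + 1) : ℝ) : ℂ) := by
    have : z - x₀ = z.im * Complex.I := by apply Complex.ext <;> simp [x₀]
    rw [this, mul_pow, Complex.I_sq]; push_cast; ring
  simp only [h, norm_mul, hz2, Complex.norm_real, norm_neg]
  rw [Real.norm_of_nonneg (by positivity)]
  nlinarith [norm_nonneg (F z), mul_nonneg (norm_nonneg (F z)) (sq_nonneg z.im)]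

/-- A bounded function on the closed lower half-plane whose boundary values decay like `|x| ^ (-n)`
decays at that rate on the whole half-plane. -/
theorem norm_pow_mul_norm_le_of_real {f : ℂ → ℂ} {B C : ℝ} (n : ℕ)
    (hf : DifferentiableOn ℂ f {z : ℂ | z.im < 0}) (hc : ContinuousOn f {z : ℂ | z.im ≤ 0})
    (hB : ∀ z : ℂ, z.im ≤ 0 → ‖f z‖ ≤ B) (hC : ∀ x : ℝ, |x| ^ n * ‖f x‖ ≤ C)
    {z : ℂ} (hz : z.im ≤ 0) : ‖z‖ ^ n * ‖f z‖ ≤ C := by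
  have hB0 : 0 ≤ B := (norm_nonneg _).trans (hB z hz)
  have hden : ∀ ε : ℝ, 0 < ε → ∀ w : ℂ, 0 ≤ w.re → 1 ≤ ‖1 + ε * w‖ ∧ ε * ‖w‖ ≤ ‖1 + ε * w‖ := by
    intro ε hε w hw
    have h0 : 0 ≤ ε * w.re := by positivity
    constructor
    · refine le_trans ?_ (Complex.re_le_norm _)
      simp [h0]
    · refine le_of_sq_le_sq ?_ (norm_nonneg _)
      rw [mul_pow, ← Complex.normSq_eq_norm_sq, ← Complex.normSq_eq_norm_sq,
        Complex.normSq_apply, Complex.normSq_apply]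
      simp
      nlinarith
  have key : ∀ ε : ℝ, 0 < ε →
      ‖z‖ ^ n * ‖f z‖ ≤ C * ‖1 + ε * (Complex.I * z)‖ ^ n := by
    intro ε hε
    set k : ℂ → ℂ := fun w => f (-Complex.I * w) * (w / (1 + ε * w)) ^ n
    have hden0 : ∀ w : ℂ, 0 ≤ w.re → (1 + ε * w : ℂ) ≠ 0 := fun w hw h => by
      have := (hden ε hε w hw).1
      rw [h, norm_zero] at this
      linarith
    have hk : ∀ w : ℂ, 0 ≤ w.re → ‖k w‖ ≤ B * (1 / ε) ^ n := by
      intro w hw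
      obtain ⟨h1, h2⟩ := hden ε hε w hw
      simp only [k, norm_mul, norm_pow, norm_div]
      gcongr ?_ * ?_ ^ n
      · exact hB _ (by simpa using hw)
      · rw [div_le_div_iff₀ (by linarith) hε]
        linarith
    have hd : DiffContOnCl ℂ k {w | 0 < w.re} := by
      refine ⟨?_, ?_⟩
      · refine (hf.comp (by fun_prop) fun w hw => ?_).mul
          ((differentiableOn_id.div (by fun_prop) fun w hw => hden0 w (le_of_lt hw)).pow n)
        simpa using hw
      · rw [Complex.closure_setOfPred_lt_re]
        refine (hc.comp (by fun_prop) fun w hw => ?_).mul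
          ((continuousOn_id.div (by fun_prop) fun w hw => hden0 w hw).pow n)
        simpa using hw
    have hPL : ‖k (Complex.I * z)‖ ≤ C := by
      refine PhragmenLindelof.right_half_plane_of_bounded_on_real hd ⟨0, by norm_num, 0, ?_⟩
        ⟨B * (1 / ε) ^ n, ?_⟩ ?_ (by simpa using hz)
      · simp only [zero_mul, Real.exp_zero]
        refine Asymptotics.IsBigO.of_bound (B * (1 / ε) ^ n) ?_
        refine Filter.eventually_inf_principal.2 (Eventually.of_forall fun w hw => ?_)
        simpa using hk w (le_of_lt hw)
      · rw [eventually_map]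
        filter_upwards [eventually_ge_atTop 0] with x hx
        exact hk x (by simpa using hx)
      · intro x
        have h1 := (hden ε hε (x * Complex.I) (by simp)).1
        have hx : -Complex.I * (x * Complex.I) = x := by
          linear_combination (-(x : ℂ)) * Complex.I_sq
        refine le_trans ?_ (hC x)
        simp only [k, norm_mul, norm_pow, norm_div, hx, Complex.norm_I, mul_one,
          Complex.norm_real, Real.norm_eq_abs]
        rw [mul_comm]
        gcongr
        exact div_le_self (abs_nonneg _) h1
    have hIz : -Complex.I * (Complex.I * z) = z := by
      linear_combination (-z) * Complex.I_sq
    have h1 := (hden ε hε (Complex.I * z) (by simpa using hz)).1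
    simp only [k, norm_mul, norm_pow, norm_div, hIz, Complex.norm_I, one_mul] at hPL
    rw [div_pow, ← mul_div_assoc, div_le_iff₀ (pow_pos (by linarith) n)] at hPL
    linarith
  have hlim : Tendsto (fun ε : ℝ => C * ‖1 + ε * (Complex.I * z)‖ ^ n)
      (nhdsWithin 0 (Set.Ioi 0)) (nhds C) := by
    refine Tendsto.mono_left ?_ nhdsWithin_le_nhds
    exact Continuous.tendsto' (by fun_prop) _ _ (by simp)
  exact ge_of_tendsto hlim (eventually_nhdsWithin_of_forall fun ε hε => key ε hε)

/-- An `H²` function with bounded boundary values is bounded. -/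
theorem HardyBelow.exists_norm_le {f : ℂ → ℂ} {B : ℝ} (hf : HardyBelow 2 f)
    (hB : ∀ x : ℝ, ‖f x‖ ≤ B) : ∃ C : ℝ, ∀ z : ℂ, z.im ≤ 0 → ‖f z‖ ≤ C := by
  obtain ⟨hd, hc, M, hM⟩ := hf
  have hM' : ∀ y : ℝ, y < 0 → Integrable (fun x : ℝ => ‖f (x + y * Complex.I) ^ 2‖) ∧
      ∫ x : ℝ, ‖f (x + y * Complex.I) ^ 2‖ ≤ M := by
    simpa only [norm_pow, Real.rpow_two] using hM
  refine ⟨√(9 * (2 * M) + 9 * B ^ 2), fun z hz => Real.le_sqrt_of_sq_le ?_⟩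
  rw [← norm_pow]
  refine norm_le_of_norm_le_div_im (F := fun z => f z ^ 2) (hd.pow 2) (hc.pow 2)
    (fun w hw => ?_) (fun x => ?_) hz
  · refine (norm_le_of_integral_norm_le (F := fun z => f z ^ 2) (hd.pow 2) hM' hw).trans_eq ?_
    rw [div_div_eq_mul_div, mul_comm]
  · rw [norm_pow]
    gcongr
    exact hB x

/-- An `H²` function with Schwartz boundary values decays faster than any polynomial. -/
theorem HardyBelow.exists_norm_mul_eval_le {f : ℂ → ℂ} (hf : HardyBelow 2 f)
    {φ : SchwartzMap ℝ ℂ} (hφ : ∀ x : ℝ, f x = φ x) (Q : Polynomial ℂ) :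
    ∃ C : ℝ, ∀ z : ℂ, z.im ≤ 0 → ‖f z * Q.eval z‖ ≤ C := by
  have hdecay : ∀ n : ℕ, ∃ C : ℝ, ∀ x : ℝ, |x| ^ n * ‖f x‖ ≤ C := by
    intro n
    obtain ⟨C, -, hC⟩ := φ.decay n 0
    exact ⟨C, fun x => by simpa [hφ] using hC x⟩
  obtain ⟨B₀, hB₀⟩ := hdecay 0
  obtain ⟨B, hB⟩ := hf.exists_norm_le (by simpa using hB₀)
  induction Q using Polynomial.induction_on' with
  | add p q hp hq =>
    obtain ⟨C, hC⟩ := hp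
    obtain ⟨D, hD⟩ := hq
    refine ⟨C + D, fun z hz => ?_⟩
    rw [Polynomial.eval_add, mul_add]
    exact norm_add_le_of_le (hC z hz) (hD z hz)
  | monomial n a =>
    obtain ⟨C, hC⟩ := hdecay n
    refine ⟨‖a‖ * C, fun z hz => ?_⟩
    rw [Polynomial.eval_monomial, norm_mul, norm_mul, norm_pow]
    calc ‖f z‖ * (‖a‖ * ‖z‖ ^ n) = ‖a‖ * (‖z‖ ^ n * ‖f z‖) := by ring
      _ ≤ ‖a‖ * C := by
        gcongr
        exact norm_pow_mul_norm_le_of_real n hf.1 hf.2.1 hB hC hz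

theorem HardyBelow.exists_norm_mul_eval_mul_le {f g : ℂ → ℂ} (P : Polynomial ℂ)
    (hf : HardyBelow 2 f) (hg : HardyBelow 2 g) {φ ψ : SchwartzMap ℝ ℂ}
    (hφ : ∀ x : ℝ, f x = φ x) (hψ : ∀ x : ℝ, g x = ψ x) :
    ∃ K : ℝ, 0 ≤ K ∧ ∀ z : ℂ, z.im ≤ 0 → ‖f z * P.eval z * g z‖ ≤ K * (1 + ‖z‖ ^ 2)⁻¹ := by
  obtain ⟨A, hA⟩ := hf.exists_norm_mul_eval_le hφ P
  obtain ⟨B, hB⟩ := hg.exists_norm_mul_eval_le hψ 1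
  obtain ⟨C, hC⟩ := hg.exists_norm_mul_eval_le hψ (Polynomial.X ^ 2)
  have hA0 : 0 ≤ A := (norm_nonneg _).trans (hA 0 (by simp))
  have hB0 : 0 ≤ B := (norm_nonneg _).trans (hB 0 (by simp))
  have hC0 : 0 ≤ C := (norm_nonneg _).trans (hC 0 (by simp))
  refine ⟨A * (B + C), by positivity, fun z hz => ?_⟩
  have hB' := hB z hz
  have hC' := hC z hz
  simp only [Polynomial.eval_one, mul_one, Polynomial.eval_pow, Polynomial.eval_X, norm_mul,
    norm_pow] at hB' hC'
  rw [← div_eq_mul_inv, le_div_iff₀ (by positivity), norm_mul, mul_assoc]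
  refine mul_le_mul (hA z hz) ?_ (by positivity) hA0
  linarith

theorem integral_norm_horizontal_le {F : ℂ → ℂ} {K : ℝ} (hc : ContinuousOn F {z : ℂ | z.im ≤ 0})
    (hK : 0 ≤ K) (hF : ∀ z : ℂ, z.im ≤ 0 → ‖F z‖ ≤ K * (1 + ‖z‖ ^ 2)⁻¹) {y : ℝ} (hy : y ≤ 0) :
    Integrable (fun x : ℝ => ‖F (x + y * Complex.I)‖) ∧
      ∫ x : ℝ, ‖F (x + y * Complex.I)‖ ≤ K * Real.pi := by
  have hcont : Continuous fun x : ℝ => F (x + y * Complex.I) :=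
    hc.comp_continuous (by fun_prop) fun x => by simpa using hy
  have hle : ∀ x : ℝ, ‖F (x + y * Complex.I)‖ ≤ K * (1 + x ^ 2)⁻¹ := by
    intro x
    have hx : x ^ 2 ≤ ‖(x + y * Complex.I : ℂ)‖ ^ 2 := by
      rw [← Complex.normSq_eq_norm_sq, Complex.normSq_add_mul_I]
      exact le_add_of_nonneg_right (sq_nonneg y)
    exact (hF _ (by simpa using hy)).trans (by gcongr)
  have hint : Integrable fun x : ℝ => K * (1 + x ^ 2)⁻¹ := integrable_inv_one_add_sq.const_mul K
  have hint' : Integrable fun x : ℝ => ‖F (x + y * Complex.I)‖ :=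
    hint.mono' hcont.norm.aestronglyMeasurable (Eventually.of_forall fun x => by simpa using hle x)
  refine ⟨hint', (integral_mono hint' hint hle).trans_eq ?_⟩
  rw [integral_const_mul, integral_univ_inv_one_add_sq]

theorem tendsto_arcLength_integral_zero {F : ℂ → ℂ} {K : ℝ} (hK : 0 ≤ K)
    (hF : ∀ z : ℂ, z.im ≤ 0 → ‖F z‖ ≤ K * (1 + ‖z‖ ^ 2)⁻¹) :
    Tendsto (fun r : ℝ => r * ∫ θ in (1 / r)..(Real.pi - 1 / r),
      ‖F (-(r * Complex.exp (θ * Complex.I)))‖) atTop (nhds 0) := by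
  have hlim : Tendsto (fun r : ℝ => K * Real.pi / r) atTop (nhds 0) :=
    tendsto_const_nhds.div_atTop tendsto_id
  refine squeeze_zero_norm' ?_ hlim
  filter_upwards [eventually_ge_atTop 1] with r hr
  have hr0 : 0 < r := by linarith
  have hinv : 1 / r ≤ 1 := by rw [div_le_one hr0]; exact hr
  have hinv0 : 0 < 1 / r := by positivity
  have hpi := Real.pi_gt_three
  have hle : ‖∫ θ in (1 / r)..(Real.pi - 1 / r), ‖F (-(r * Complex.exp (θ * Complex.I)))‖‖ ≤
      K * (1 + r ^ 2)⁻¹ * |Real.pi - 1 / r - 1 / r| := by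
    refine intervalIntegral.norm_integral_le_of_norm_le_const fun θ hθ => ?_
    rw [Set.uIoc_of_le (by linarith)] at hθ
    have hsin : 0 ≤ Real.sin θ :=
      Real.sin_nonneg_of_nonneg_of_le_pi (by linarith [hθ.1]) (by linarith [hθ.2])
    have him : (-(r * Complex.exp (θ * Complex.I))).im ≤ 0 := by
      simp only [Complex.neg_im, Complex.im_ofReal_mul, Complex.exp_ofReal_mul_I_im]
      have : 0 ≤ r * Real.sin θ := by positivity
      linarith
    have := hF _ him
    rwa [norm_neg, norm_mul, Complex.norm_exp_ofReal_mul_I, mul_one, Complex.norm_real,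
      Real.norm_of_nonneg hr0.le, ← norm_norm] at this
  have habs : |Real.pi - 1 / r - 1 / r| ≤ Real.pi := by
    rw [abs_of_nonneg (by linarith)]; linarith
  rw [norm_mul, Real.norm_of_nonneg hr0.le]
  calc r * ‖∫ θ in (1 / r)..(Real.pi - 1 / r), ‖F (-(r * Complex.exp (θ * Complex.I)))‖‖
      ≤ r * (K * (1 + r ^ 2)⁻¹ * Real.pi) := by
        gcongr
        exact hle.trans (by gcongr)
    _ ≤ r * (K * (r ^ 2)⁻¹ * Real.pi) := by
        gcongr
        linarith
    _ = K * Real.pi / r := by field_simp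

/-- If `f, g` are Hardy class from below of order 2 with Schwartz boundary values
and `P` is a complex polynomial, then `z ↦ f(z)·P(z)·g(z)` is Hardy class from
below of order 1, and its arc-length integrals along the arcs
`C_r = {-r e^{iθ} : 1/r ≤ θ ≤ π - 1/r}` tend to `0` as `r → ∞`. -/
theorem hardyBelow_poly_mul (f g : ℂ → ℂ) (P : Polynomial ℂ)
    (hf : HardyBelow 2 f) (hg : HardyBelow 2 g)
    (hfS : ∃ φ : SchwartzMap ℝ ℂ, ∀ x : ℝ, f ↑x = φ x)
    (hgS : ∃ ψ : SchwartzMap ℝ ℂ, ∀ x : ℝ, g ↑x = ψ x) :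
    HardyBelow 1 (fun z => f z * P.eval z * g z) ∧
    Tendsto (fun r : ℝ =>
        r * ∫ θ in (1 / r)..(Real.pi - 1 / r),
          ‖f (-(↑r * Complex.exp (↑θ * Complex.I))) *
            P.eval (-(↑r * Complex.exp (↑θ * Complex.I))) *
            g (-(↑r * Complex.exp (↑θ * Complex.I)))‖)
      atTop (nhds 0) := by
  obtain ⟨φ, hφ⟩ := hfS
  obtain ⟨ψ, hψ⟩ := hgS
  obtain ⟨K, hK, hle⟩ := HardyBelow.exists_norm_mul_eval_mul_le P hf hg hφ hψ
  have hc : ContinuousOn (fun z => f z * P.eval z * g z) {z : ℂ | z.im ≤ 0} :=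
    (hf.2.1.mul P.continuous.continuousOn).mul hg.2.1
  refine ⟨⟨(hf.1.mul P.differentiable.differentiableOn).mul hg.1, hc, K * Real.pi,
    fun y hy => ?_⟩, tendsto_arcLength_integral_zero (F := fun z => f z * P.eval z * g z) hK hle⟩
  simpa only [Real.rpow_one] using integral_norm_horizontal_le hc hK hle hy.le
end

section
/- Let f and g each be Hardy class from below of order 2, and let z_R ∈ ℂ with Im z_R < 0. Then ∫_ℝ f(t) g(t)/(t − z_R) dt = −2πi f(z_R) g(z_R), where the integral is over the boundary values on the real axis. (Pole-term identity: the full real-line integral of the Breit-Wigner kernel against the product of Hardy boundary functions reproduces the value at the pole.) -/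
open MeasureTheory Filter

lemma ContinuousOn.continuous_horizontal_section {q : ℂ → ℂ}
    (hq : ContinuousOn q {z : ℂ | z.im ≤ 0}) {y : ℝ} (hy : y ≤ 0) :
    Continuous fun x : ℝ => q (x + y * Complex.I) :=
  hq.comp_continuous (by fun_prop) fun x => by simpa using hy

/-- Fatou's lemma for the horizontal sections of a function that is continuous on the closed
lower half-plane. -/
lemma integrable_horizontal_section_of_nonpos {q : ℂ → ℂ} {M : ℝ}
    (hq : ContinuousOn q {z : ℂ | z.im ≤ 0})
    (hM : ∀ y : ℝ, y < 0 → Integrable (fun x : ℝ => q (x + y * Complex.I)) ∧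
      ∫ x : ℝ, ‖q (x + y * Complex.I)‖ ≤ M) {y : ℝ} (hy : y ≤ 0) :
    Integrable (fun x : ℝ => q (x + y * Complex.I)) ∧
      ∫ x : ℝ, ‖q (x + y * Complex.I)‖ ≤ M := by
  have hM0 : 0 ≤ M := (integral_nonneg fun _ => norm_nonneg _).trans (hM (-1) (by norm_num)).2
  obtain ⟨u, hneg, hlim⟩ : ∃ u : ℕ → ℝ, (∀ n, u n < 0) ∧ Tendsto u atTop (nhds y) := by
    refine ⟨fun n => y - 1 / ((n : ℝ) + 1), fun n => ?_, ?_⟩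
    · have : 0 < 1 / ((n : ℝ) + 1) := by positivity
      linarith
    · simpa using tendsto_const_nhds.sub (tendsto_one_div_add_atTop_nhds_zero_nat (𝕜 := ℝ))
  have hmeas := (hq.continuous_horizontal_section hy).aestronglyMeasurable (μ := volume)
  have key : eLpNorm (fun x : ℝ => q (x + y * Complex.I)) 1 volume ≤ ENNReal.ofReal M := by
    refine Lp.eLpNorm_le_of_ae_tendsto (u := atTop)
      (f := fun (n : ℕ) (x : ℝ) => q (x + u n * Complex.I))
      (Eventually.of_forall fun n => ?_)
      (fun n => (hM _ (hneg n)).1.aestronglyMeasurable) (ae_of_all _ fun x => ?_)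
    · rw [eLpNorm_one_eq_lintegral_enorm,
        ← ofReal_integral_norm_eq_lintegral_enorm (hM _ (hneg n)).1]
      exact ENNReal.ofReal_le_ofReal (hM _ (hneg n)).2
    · refine (hq (x + y * Complex.I) (by simpa using hy)).tendsto.comp
        (tendsto_nhdsWithin_iff.2 ⟨?_, Eventually.of_forall fun n => by
          simpa using (hneg n).le⟩)
      have hcont : Continuous fun t : ℝ => (x : ℂ) + t * Complex.I := by fun_prop
      exact (hcont.tendsto y).comp hlim
  have hint : Integrable (fun x : ℝ => q (x + y * Complex.I)) :=
    memLp_one_iff_integrable.1 ⟨hmeas, key.trans_lt ENNReal.ofReal_lt_top⟩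
  refine ⟨hint, ?_⟩
  rw [eLpNorm_one_eq_lintegral_enorm, ← ofReal_integral_norm_eq_lintegral_enorm hint] at key
  exact (ENNReal.ofReal_le_ofReal_iff hM0).1 key

lemma inv_sub_sq_add_sq_eq (a : ℝ) {b : ℝ} (hb : b ≠ 0) (x : ℝ) :
    ((x - a) ^ 2 + b ^ 2)⁻¹ = (b ^ 2)⁻¹ * (1 + ((x - a) / b) ^ 2)⁻¹ := by
  rw [← mul_inv]
  congr 1
  field

lemma integrable_inv_sub_sq_add_sq (a : ℝ) {b : ℝ} (hb : b ≠ 0) :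
    Integrable fun x : ℝ => ((x - a) ^ 2 + b ^ 2)⁻¹ := by
  simp_rw [inv_sub_sq_add_sq_eq a hb]
  exact ((integrable_inv_one_add_sq.comp_div hb).comp_sub_right a).const_mul _

lemma integral_inv_sub_sq_add_sq (a : ℝ) {b : ℝ} (hb : b ≠ 0) :
    ∫ x : ℝ, ((x - a) ^ 2 + b ^ 2)⁻¹ = Real.pi / |b| := by
  simp_rw [inv_sub_sq_add_sq_eq a hb]
  rw [integral_const_mul, integral_sub_right_eq_self (fun x : ℝ => (1 + (x / b) ^ 2)⁻¹),
    Measure.integral_comp_div (fun x : ℝ => (1 + x ^ 2)⁻¹), integral_univ_inv_one_add_sq,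
    smul_eq_mul, ← sq_abs b]
  have := abs_pos.2 hb
  field

/-- Contour shift: if the `L¹` norms of the horizontal sections are uniformly bounded, the integral
over a horizontal line does not depend on the line. -/
lemma integral_horizontal_section_eq {q : ℂ → ℂ} {M : ℝ}
    (hd : DifferentiableOn ℂ q {z : ℂ | z.im < 0})
    (hc : ContinuousOn q {z : ℂ | z.im ≤ 0})
    (hM : ∀ y : ℝ, y ≤ 0 → Integrable (fun x : ℝ => q (x + y * Complex.I)) ∧
      ∫ x : ℝ, ‖q (x + y * Complex.I)‖ ≤ M) {y : ℝ} (hy : y ≤ 0) :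
    ∫ x : ℝ, q x = ∫ x : ℝ, q (x + y * Complex.I) := by
  have hM0 : ∀ᵐ t : ℝ ∂volume.restrict (Set.Ioc y 0), t ≤ 0 := by
    filter_upwards [ae_restrict_mem measurableSet_Ioc] with t ht using ht.2
  have hmeas : AEStronglyMeasurable (fun p : ℝ × ℝ => q (p.1 + p.2 * Complex.I))
      ((volume : Measure ℝ).prod (volume.restrict (Set.Ioc y 0))) := by
    have hcont : ContinuousOn (fun p : ℝ × ℝ => q (p.1 + p.2 * Complex.I))
        (Set.univ ×ˢ Set.Ioc y 0) :=
      hc.comp (by fun_prop) fun p hp => by simpa using hp.2.2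
    have := hcont.aestronglyMeasurable (μ := volume) (MeasurableSet.univ.prod measurableSet_Ioc)
    rwa [Measure.volume_eq_prod, ← Measure.prod_restrict, Measure.restrict_univ] at this
  have hprod : Integrable (fun p : ℝ × ℝ => q (p.1 + p.2 * Complex.I))
      ((volume : Measure ℝ).prod (volume.restrict (Set.Ioc y 0))) := by
    refine (integrable_prod_iff' hmeas).2 ⟨hM0.mono fun t ht => (hM t ht).1, ?_⟩
    refine Integrable.of_bound hmeas.norm.prod_swap.integral_prod_right' M
      (hM0.mono fun t ht => ?_)
    rw [Real.norm_of_nonneg (integral_nonneg fun _ => norm_nonneg _)]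
    exact (hM t ht).2
  have hV : Integrable fun x : ℝ => ∫ t : ℝ in y..0, q (x + t * Complex.I) := by
    simp_rw [intervalIntegral.integral_of_le hy]
    exact hprod.integral_prod_left
  have h0 : ∀ x : ℝ, q x = q (x + (0 : ℝ) * Complex.I) := fun x => by simp
  have hrect : ∀ R : ℝ, (∫ x : ℝ in -R..R, q x) - ∫ x : ℝ in -R..R, q (x + y * Complex.I) =
      Complex.I * ((∫ t : ℝ in y..0, q (R + t * Complex.I)) -
        ∫ t : ℝ in y..0, q (↑(-R) + t * Complex.I)) := fun R => by
    have := Complex.integral_boundary_rect_eq_zero_of_continuousOn_of_differentiableOn q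
      ⟨-R, y⟩ ⟨R, 0⟩ (hc.mono fun z hz => ?_) (hd.mono fun z hz => ?_)
    · simp only [smul_eq_mul] at this
      simp_rw [h0]
      linear_combination -this
    · have := (Complex.mem_reProdIm.1 hz).2
      simp only [Set.uIcc_of_le hy] at this
      exact this.2
    · have := (Complex.mem_reProdIm.1 hz).2
      simp only [max_eq_right hy] at this
      exact this.2
  have hlim : Tendsto (fun R : ℝ => (∫ x : ℝ in -R..R, q x) -
      ∫ x : ℝ in -R..R, q (x + y * Complex.I)) atTop
      (nhds ((∫ x : ℝ, q x) - ∫ x : ℝ, q (x + y * Complex.I))) := by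
    refine (intervalIntegral_tendsto_integral ?_ tendsto_neg_atTop_atBot tendsto_id).sub
      (intervalIntegral_tendsto_integral (hM y hy).1 tendsto_neg_atTop_atBot tendsto_id)
    simp_rw [h0]
    exact (hM 0 le_rfl).1
  simp_rw [hrect] at hlim
  refine sub_eq_zero.1 (IntegrableAtFilter.eq_zero_of_tendsto (μ := volume)
    (((hV.sub hV.comp_neg).const_mul Complex.I).integrableAtFilter _) (fun s hs => ?_) hlim)
  obtain ⟨b, hb⟩ := mem_atTop_sets.1 hs
  rw [← top_le_iff, ← Real.volume_Ici (a := b)]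
  exact measure_mono hb

section PoleRemoved

open ComplexConjugate

/-- The difference quotient at `z` of `h` corrected by a multiple of `w ↦ 1 / (w - conj z)`, so
that the corrected function vanishes at `z`. -/
noncomputable def poleRemoved (h : ℂ → ℂ) (z : ℂ) : ℂ → ℂ :=
  dslope (fun w => h w - h z * ((z - conj z) / (w - conj z))) z

variable {h : ℂ → ℂ} {z w : ℂ}

lemma sub_conj_ne_zero_of_im_nonpos (hz : z.im < 0) (hw : w.im ≤ 0) : w - conj z ≠ 0 := by
  intro H
  have := congrArg Complex.im H
  simp at this
  linarith

lemma norm_sub_le_norm_sub_conj (hz : z.im < 0) (hw : w.im ≤ 0) : ‖w - z‖ ≤ ‖w - conj z‖ := by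
  refine (sq_le_sq₀ (norm_nonneg _) (norm_nonneg _)).1 ?_
  rw [Complex.sq_norm, Complex.sq_norm, Complex.normSq_apply, Complex.normSq_apply]
  simp
  nlinarith [mul_nonneg_of_nonpos_of_nonpos hz.le hw]

lemma poleRemoved_of_ne (hz : z.im < 0) (hwz : w ≠ z) :
    poleRemoved h z w =
      h w / (w - z) - h z * (z - conj z) / ((w - z) * (w - conj z)) := by
  have h1 := sub_conj_ne_zero_of_im_nonpos hz hz.le
  rw [poleRemoved, dslope_of_ne _ hwz, slope_def_field, div_self h1]
  simp only [mul_one, sub_self, sub_zero]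
  rw [sub_div, mul_div_assoc', div_div, mul_comm (w - conj z)]

lemma norm_poleRemoved_le (hz : z.im < 0) (hw : w.im ≤ 0) (hwz : w ≠ z) :
    ‖poleRemoved h z w‖ ≤ ‖h w‖ / ‖w - z‖ + ‖h z * (z - conj z)‖ / ‖w - z‖ ^ 2 := by
  have hpos : 0 < ‖w - z‖ := norm_pos_iff.2 (sub_ne_zero.2 hwz)
  rw [poleRemoved_of_ne hz hwz]
  refine (norm_sub_le _ _).trans ?_
  rw [norm_div, norm_div _ (_ * _), norm_mul (w - z), sq]
  gcongr
  exact norm_sub_le_norm_sub_conj hz hw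

lemma differentiableOn_sub_mul_div (hz : z.im < 0)
    (hd : DifferentiableOn ℂ h {z : ℂ | z.im < 0}) :
    DifferentiableOn ℂ (fun w => h w - h z * ((z - conj z) / (w - conj z)))
      {z : ℂ | z.im < 0} :=
  hd.sub ((DifferentiableOn.div (by fun_prop) (by fun_prop)
    fun w hw => sub_conj_ne_zero_of_im_nonpos hz (le_of_lt hw)).const_mul _)

lemma setOf_im_neg_mem_nhds (hz : z.im < 0) : {z : ℂ | z.im < 0} ∈ nhds z :=
  (isOpen_lt Complex.continuous_im continuous_const).mem_nhds hz

lemma differentiableOn_poleRemoved (hz : z.im < 0)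
    (hd : DifferentiableOn ℂ h {z : ℂ | z.im < 0}) :
    DifferentiableOn ℂ (poleRemoved h z) {z : ℂ | z.im < 0} :=
  (Complex.differentiableOn_dslope (setOf_im_neg_mem_nhds hz)).2
    (differentiableOn_sub_mul_div hz hd)

lemma continuousOn_poleRemoved (hz : z.im < 0)
    (hd : DifferentiableOn ℂ h {z : ℂ | z.im < 0})
    (hc : ContinuousOn h {z : ℂ | z.im ≤ 0}) :
    ContinuousOn (poleRemoved h z) {z : ℂ | z.im ≤ 0} := by
  have hmem := setOf_im_neg_mem_nhds hz
  have hcont : ContinuousOn (fun w => h w - h z * ((z - conj z) / (w - conj z)))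
      {z : ℂ | z.im ≤ 0} :=
    hc.sub (continuousOn_const.mul (ContinuousOn.div (by fun_prop) (by fun_prop)
      fun w hw => sub_conj_ne_zero_of_im_nonpos hz hw))
  have hsub : {z : ℂ | z.im < 0} ⊆ {z : ℂ | z.im ≤ 0} :=
    Set.ofPred_subset_ofPred.2 fun w hw => le_of_lt hw
  exact (continuousOn_dslope (mem_of_superset hmem hsub)).2
    ⟨hcont, (differentiableOn_sub_mul_div hz hd).differentiableAt hmem⟩

lemma exists_norm_poleRemoved_le (hz : z.im < 0)
    (hd : DifferentiableOn ℂ h {z : ℂ | z.im < 0})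
    (hc : ContinuousOn h {z : ℂ | z.im ≤ 0}) :
    ∃ C : ℝ, 0 ≤ C ∧ ∀ w : ℂ, w.im ≤ 0 →
      ‖poleRemoved h z w‖ ≤ C * (‖h w‖ + ((w.re - z.re) ^ 2 + z.im ^ 2)⁻¹) := by
  have hK : Metric.closedBall z (-z.im) ⊆ {z : ℂ | z.im ≤ 0} := fun w hw => by
    have h1 := (abs_le.1 ((Complex.abs_im_le_norm (w - z)).trans (mem_closedBall_iff_norm.1 hw))).2
    simp only [Complex.sub_im] at h1
    simp only [Set.mem_ofPred_eq]
    linarith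
  obtain ⟨C₁, hC₁⟩ := (isCompact_closedBall z (-z.im)).exists_bound_of_continuousOn
    ((continuousOn_poleRemoved hz hd hc).mono hK)
  have hb : 0 < -z.im := by linarith
  have hC₁0 : 0 ≤ C₁ := (norm_nonneg _).trans (hC₁ z (Metric.mem_closedBall_self hb.le))
  set D := ‖h z * (z - conj z)‖
  have hD : 0 ≤ D := norm_nonneg _
  refine ⟨(-z.im)⁻¹ + 2 * D + C₁ * (2 * z.im ^ 2), by positivity, fun w hw => ?_⟩
  have hP : 0 < (w.re - z.re) ^ 2 + z.im ^ 2 := by nlinarith [sq_nonneg (w.re - z.re)]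
  have hre : (w.re - z.re) ^ 2 ≤ ‖w - z‖ ^ 2 := by
    rw [Complex.sq_norm, Complex.normSq_apply]
    simp
    nlinarith [mul_self_nonneg (w.im - z.im)]
  have hh : 0 ≤ ‖h w‖ := norm_nonneg _
  set L := ((w.re - z.re) ^ 2 + z.im ^ 2)⁻¹ with hL
  have hL0 : 0 ≤ L := by positivity
  have hz2 : 0 ≤ z.im ^ 2 := sq_nonneg _
  by_cases hwz : ‖w - z‖ ≤ -z.im
  · have h1 : 1 ≤ 2 * z.im ^ 2 * L := by
      rw [hL, ← div_eq_mul_inv, one_le_div hP]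
      nlinarith [norm_nonneg (w - z)]
    calc ‖poleRemoved h z w‖ ≤ C₁ := hC₁ w (mem_closedBall_iff_norm.2 hwz)
      _ ≤ C₁ * (2 * z.im ^ 2 * L) := le_mul_of_one_le_right hC₁0 h1
      _ = (C₁ * (2 * z.im ^ 2)) * L := by ring
      _ ≤ _ := by
        gcongr
        · exact le_add_of_nonneg_left (by positivity)
        · exact le_add_of_nonneg_left hh
  · push Not at hwz
    have hpos : 0 < ‖w - z‖ := hb.trans hwz
    have hne : w ≠ z := sub_ne_zero.1 (norm_pos_iff.1 hpos)
    have h2 : ‖h w‖ / ‖w - z‖ ≤ (-z.im)⁻¹ * ‖h w‖ := by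
      rw [div_eq_inv_mul]
      gcongr
    have h3 : D / ‖w - z‖ ^ 2 ≤ 2 * D * L := by
      rw [hL, ← div_eq_mul_inv, div_le_div_iff₀ (by positivity) hP]
      nlinarith [mul_le_mul_of_nonneg_left hre hD,
        mul_le_mul_of_nonneg_left (show z.im ^ 2 ≤ ‖w - z‖ ^ 2 by nlinarith) hD]
    refine (norm_poleRemoved_le hz hw hne).trans ((add_le_add h2 h3).trans ?_)
    rw [mul_add]
    gcongr
    · rw [add_assoc]
      exact le_add_of_nonneg_right (by positivity)
    · rw [add_right_comm]
      exact le_add_of_nonneg_left (by positivity)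

end PoleRemoved

/-- The integral of `poleRemoved h z` over the real line vanishes: shift the line to `-i∞`. -/
lemma integral_poleRemoved_eq_zero {h : ℂ → ℂ} {z : ℂ} {M : ℝ} (hz : z.im < 0)
    (hd : DifferentiableOn ℂ h {z : ℂ | z.im < 0})
    (hc : ContinuousOn h {z : ℂ | z.im ≤ 0})
    (hM : ∀ y : ℝ, y ≤ 0 → Integrable (fun x : ℝ => h (x + y * Complex.I)) ∧
      ∫ x : ℝ, ‖h (x + y * Complex.I)‖ ≤ M) :
    ∫ x : ℝ, poleRemoved h z x = 0 := by
  have hqc := continuousOn_poleRemoved hz hd hc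
  obtain ⟨C, hC0, hC⟩ := exists_norm_poleRemoved_le hz hd hc
  have hq : ∀ y : ℝ, y ≤ 0 → Integrable (fun x : ℝ => poleRemoved h z (x + y * Complex.I)) ∧
      ∫ x : ℝ, ‖poleRemoved h z (x + y * Complex.I)‖ ≤ C * (M + Real.pi / |z.im|) := by
    intro y hy
    have hbound : ∀ x : ℝ, ‖poleRemoved h z (x + y * Complex.I)‖ ≤
        C * (‖h (x + y * Complex.I)‖ + ((x - z.re) ^ 2 + z.im ^ 2)⁻¹) := fun x => by
      simpa using hC (x + y * Complex.I) (by simpa using hy)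
    have hi := ((hM y hy).1.norm.add (integrable_inv_sub_sq_add_sq z.re hz.ne)).const_mul C
    have hqi : Integrable (fun x : ℝ => poleRemoved h z (x + y * Complex.I)) :=
      hi.mono' (hqc.continuous_horizontal_section hy).aestronglyMeasurable (ae_of_all _ hbound)
    refine ⟨hqi, (integral_mono hqi.norm hi hbound).trans ?_⟩
    simp only [Pi.add_apply]
    rw [integral_const_mul, integral_add (hM y hy).1.norm (integrable_inv_sub_sq_add_sq _ hz.ne),
      integral_inv_sub_sq_add_sq _ hz.ne]
    gcongr
    exact (hM y hy).2
  set D := ‖h z * (z - (starRingEnd ℂ) z)‖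
  have hdecay : ∀ s : ℝ, 0 < s → ‖∫ x : ℝ, poleRemoved h z x‖ ≤ (M + D * Real.pi) * s⁻¹ := by
    intro s hs
    have hy : z.im - s ≤ 0 := by linarith
    rw [integral_horizontal_section_eq (differentiableOn_poleRemoved hz hd) hqc hq hy]
    have hi := ((hM _ hy).1.norm.const_mul s⁻¹).add
      ((integrable_inv_sub_sq_add_sq z.re hs.ne').const_mul D)
    refine (norm_integral_le_integral_norm _).trans
      ((integral_mono (hq _ hy).1.norm hi fun x => ?_).trans ?_)
    · set w : ℂ := x + ↑(z.im - s) * Complex.I with hw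
      have hre : w.re = x := by simp [hw]
      have him : w.im = z.im - s := by simp [hw]
      have hsq : ‖w - z‖ ^ 2 = (x - z.re) ^ 2 + s ^ 2 := by
        rw [Complex.sq_norm, Complex.normSq_apply, Complex.sub_re, Complex.sub_im, hre, him]
        ring
      have hsw : s ≤ ‖w - z‖ := by
        refine (sq_le_sq₀ hs.le (norm_nonneg _)).1 ?_
        rw [hsq]
        nlinarith [sq_nonneg (x - z.re)]
      have hne : w ≠ z := sub_ne_zero.1 (norm_pos_iff.1 (hs.trans_le hsw))
      refine (norm_poleRemoved_le hz (him.trans_le hy) hne).trans ?_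
      rw [hsq, div_eq_inv_mul, div_eq_mul_inv]
      simp only [Pi.add_apply]
      gcongr
    · simp only [Pi.add_apply]
      rw [integral_add ((hM _ hy).1.norm.const_mul s⁻¹)
        ((integrable_inv_sub_sq_add_sq z.re hs.ne').const_mul D), integral_const_mul,
        integral_const_mul, integral_inv_sub_sq_add_sq _ hs.ne', abs_of_pos hs, add_mul,
        mul_comm s⁻¹, div_eq_mul_inv, ← mul_assoc]
      gcongr
      exact (hM _ hy).2
  have hlim : Tendsto (fun s : ℝ => (M + D * Real.pi) * s⁻¹) atTop (nhds 0) := by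
    simpa using tendsto_inv_atTop_zero.const_mul (M + D * Real.pi)
  refine norm_le_zero_iff.1 (ge_of_tendsto hlim ?_)
  filter_upwards [eventually_gt_atTop 0] with s hs using hdecay s hs

/-- Cauchy's integral formula in the lower half-plane for a function whose horizontal sections are
uniformly bounded in `L¹`. -/
lemma integral_div_sub_eq_of_integrable_sections {h : ℂ → ℂ} {z : ℂ} {M : ℝ} (hz : z.im < 0)
    (hd : DifferentiableOn ℂ h {z : ℂ | z.im < 0})
    (hc : ContinuousOn h {z : ℂ | z.im ≤ 0})
    (hM : ∀ y : ℝ, y < 0 → Integrable (fun x : ℝ => h (x + y * Complex.I)) ∧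
      ∫ x : ℝ, ‖h (x + y * Complex.I)‖ ≤ M) :
    ∫ t : ℝ, h t / (t - z) = -(2 * Real.pi * Complex.I) * h z := by
  have hM' := fun (y : ℝ) (hy : y ≤ 0) => integrable_horizontal_section_of_nonpos hc hM hy
  have hne : ∀ t : ℝ, (t : ℂ) ≠ z := fun t ht => by simp [← ht] at hz
  have hker : ∀ t : ℝ, h z * (z - (starRingEnd ℂ) z) / ((t - z) * (t - (starRingEnd ℂ) z)) =
      h z * (z - (starRingEnd ℂ) z) * ↑(((t - z.re) ^ 2 + z.im ^ 2)⁻¹) := fun t => by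
    rw [div_eq_mul_inv]
    congr 1
    have : (t : ℂ) - (starRingEnd ℂ) z = (starRingEnd ℂ) (t - z) := by simp
    rw [this, Complex.mul_conj, Complex.normSq_apply]
    push_cast
    simp [sq]
  have hkint : Integrable fun t : ℝ =>
      h z * (z - (starRingEnd ℂ) z) * ((((t - z.re) ^ 2 + z.im ^ 2)⁻¹ : ℝ) : ℂ) :=
    (integrable_inv_sub_sq_add_sq z.re hz.ne).ofReal.const_mul _
  have hhint : Integrable fun t : ℝ => h t / (t - z) := by
    have h0 : Integrable fun t : ℝ => h t := by simpa using (hM' 0 le_rfl).1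
    simp_rw [div_eq_mul_inv]
    refine h0.mul_bdd (c := (-z.im)⁻¹)
      (Continuous.inv₀ (by fun_prop) fun t => sub_ne_zero.2 (hne t)).aestronglyMeasurable
      (ae_of_all _ fun t => ?_)
    rw [norm_inv]
    have : -z.im ≤ ‖(t : ℂ) - z‖ := by
      simpa using (le_abs_self _).trans (Complex.abs_im_le_norm ((t : ℂ) - z))
    have hz' : 0 < -z.im := by linarith
    gcongr
  have key := integral_poleRemoved_eq_zero hz hd hc hM'
  simp_rw [fun t : ℝ => poleRemoved_of_ne (h := h) hz (hne t), hker] at key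
  rw [integral_sub hhint hkint, sub_eq_zero] at key
  rw [key, integral_const_mul, integral_complex_ofReal, integral_inv_sub_sq_add_sq _ hz.ne, abs_of_neg hz,
    Complex.sub_conj]
  have : (z.im : ℂ) ≠ 0 := by exact_mod_cast hz.ne
  push_cast
  field

lemma HardyBelow.exists_integral_norm_mul_le {f g : ℂ → ℂ} (hf : HardyBelow 2 f)
    (hg : HardyBelow 2 g) :
    ∃ M : ℝ, ∀ y : ℝ, y < 0 →
      Integrable (fun x : ℝ => f (x + y * Complex.I) * g (x + y * Complex.I)) ∧
      ∫ x : ℝ, ‖f (x + y * Complex.I) * g (x + y * Complex.I)‖ ≤ M := by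
  obtain ⟨-, hfc, A, hA⟩ := hf
  obtain ⟨-, hgc, B, hB⟩ := hg
  simp only [Real.rpow_two] at hA hB
  refine ⟨(A + B) / 2, fun y hy => ?_⟩
  have hi := ((hA y hy).1.add (hB y hy).1).div_const 2
  have hbound : ∀ x : ℝ, ‖f (x + y * Complex.I) * g (x + y * Complex.I)‖ ≤
      (‖f (x + y * Complex.I)‖ ^ 2 + ‖g (x + y * Complex.I)‖ ^ 2) / 2 := fun x => by
    rw [norm_mul]
    linarith [two_mul_le_add_sq ‖f (x + y * Complex.I)‖ ‖g (x + y * Complex.I)‖]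
  have hint : Integrable (fun x : ℝ => f (x + y * Complex.I) * g (x + y * Complex.I)) :=
    hi.mono' ((hfc.continuous_horizontal_section hy.le).mul
      (hgc.continuous_horizontal_section hy.le)).aestronglyMeasurable (ae_of_all _ hbound)
  refine ⟨hint, (integral_mono hint.norm hi hbound).trans ?_⟩
  simp only [Pi.add_apply]
  rw [integral_div, integral_add (hA y hy).1 (hB y hy).1]
  linarith [(hA y hy).2, (hB y hy).2]

/-- Pole-term identity: for `f, g` Hardy class from below of order 2 and a pole
`z_R` in the open lower half-plane,
`∫ f(t)g(t)/(t - z_R) dt = -2πi f(z_R) g(z_R)`. -/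
theorem hardyBelow_pole_term (f g : ℂ → ℂ)
    (hf : HardyBelow 2 f) (hg : HardyBelow 2 g)
    (zR : ℂ) (hzR : zR.im < 0) :
    ∫ t : ℝ, f ↑t * g ↑t / (↑t - zR) =
      -(2 * Real.pi * Complex.I) * (f zR * g zR) := by
  obtain ⟨M, hM⟩ := hf.exists_integral_norm_mul_le hg
  exact integral_div_sub_eq_of_integrable_sections (h := fun w => f w * g w) hzR
    (hf.1.mul hg.1) (hf.2.1.mul hg.2.1) hM
end

section
/- Let g be Hardy class from below of order 2 with Schwartz restriction to the real axis, and let z_R ∈ ℂ with Im z_R < 0. Define w : ℝ → ℂ by w(t) = √t for t ≥ 0 and w(t) = −i√(−t) for t < 0 (the boundary value from below of the branch of the complex square root with argument in [−π, π)), and let √z_R denote the square root of z_R with argument in (−π/2, 0), i.e., the one lying in the lower half-plane. Then ∫_ℝ w(t) g(t)/(t − z_R) dt = −2πi (√z_R) g(z_R). (Generalized eigenvalue identity for the mass operator M = (P_μ P^μ)^{1/2} with complex eigenvalue √z_R.) -/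
open MeasureTheory Filter

open scoped ENNReal Topology

/-- The integrals of `Φ` over two horizontal lines agree when `Φ` is absolutely integrable
over the strip between them. -/
theorem integral_horizontal_eq_of_lintegral_strip {Φ : ℂ → ℂ} {T : ℝ} (hT : 0 < T)
    (hd : DifferentiableOn ℂ Φ {z : ℂ | z.im < 0})
    (hc : ContinuousOn Φ {z : ℂ | z.im ≤ 0})
    (h0 : Integrable fun x : ℝ => Φ x)
    (h1 : Integrable fun x : ℝ => Φ (↑x + ↑(-T) * Complex.I))
    {K : ℝ≥0∞} (hK : K ≠ ⊤)
    (hb : ∀ y : ℝ, y < 0 → ∫⁻ x : ℝ, ‖Φ (↑x + ↑y * Complex.I)‖ₑ ≤ K) :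
    ∫ x : ℝ, Φ (↑x + ↑(-T) * Complex.I) = ∫ x : ℝ, Φ x := by
  set a : ℝ → ℝ≥0∞ := fun x => ∫⁻ y in Set.Ioo (-T) 0, ‖Φ (↑x + ↑y * Complex.I)‖ₑ with ha
  have hmeas : AEMeasurable (Function.uncurry fun x y : ℝ => ‖Φ (↑x + ↑y * Complex.I)‖ₑ)
      ((volume : Measure ℝ).prod (volume.restrict (Set.Ioo (-T) 0))) := by
    have hco : ContinuousOn (fun p : ℝ × ℝ => Φ (↑p.1 + ↑p.2 * Complex.I))
        (Set.univ ×ˢ Set.Ioo (-T) 0) := by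
      refine hc.comp (by fun_prop) ?_
      rintro ⟨x, y⟩ ⟨-, hy⟩
      simpa using hy.2.le
    have := (hco.aemeasurable (μ := (volume : Measure ℝ).prod volume)
      (MeasurableSet.univ.prod measurableSet_Ioo)).enorm
    rwa [← Measure.prod_restrict, Measure.restrict_univ] at this
  have haint : ∫⁻ x, a x ≠ ⊤ := by
    rw [ha, lintegral_lintegral_swap hmeas]
    refine ne_top_of_le_ne_top (ENNReal.mul_ne_top hK (b := volume (Set.Ioo (-T) 0)) (by simp)) ?_
    rw [← setLIntegral_const]
    exact setLIntegral_mono measurable_const fun y hy => hb y hy.2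
  have hameas : AEMeasurable a := hmeas.lintegral_prod_right'
  have hsum : ∫⁻ x, (a x + a (-x)) ≠ ⊤ := by
    rw [lintegral_add_left' hameas, lintegral_neg_eq_self (μ := volume) a]
    simpa using haint
  set D : ℝ → ℂ := fun R =>
    (∫ x in (-R)..R, Φ (↑x + ↑(-T) * Complex.I)) - ∫ x in (-R)..R, Φ x with hD
  have hside : ∀ x : ℝ, ‖∫ y in (-T)..0, Φ (↑x + ↑y * Complex.I)‖ₑ ≤ a x := fun x => by
    rw [intervalIntegral.integral_of_le (by linarith), integral_Ioc_eq_integral_Ioo]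
    exact enorm_integral_le_lintegral_enorm _
  have hDb : ∀ R : ℝ, 0 ≤ R → ‖D R‖ₑ ≤ a R + a (-R) := fun R hR => by
    have h := Complex.integral_boundary_rect_eq_zero_of_continuousOn_of_differentiableOn Φ
      (⟨-R, -T⟩ : ℂ) (⟨R, 0⟩ : ℂ) (hc.mono ?_) (hd.mono ?_)
    · have h' : D R = Complex.I * (∫ y in (-T)..0, Φ (↑(-R) + ↑y * Complex.I))
          - Complex.I * (∫ y in (-T)..0, Φ (↑R + ↑y * Complex.I)) := by
        simp only [Complex.ofReal_zero, zero_mul, add_zero, smul_eq_mul] at h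
        simp only [hD]
        linear_combination h
      rw [h']
      refine (enorm_sub_le).trans ?_
      rw [enorm_mul, enorm_mul, add_comm]
      have hI : ‖Complex.I‖ₑ = 1 := by simp [← ofReal_norm]
      rw [hI, one_mul, one_mul]
      exact add_le_add (hside R) (hside (-R))
    · rintro z ⟨-, hz⟩
      simp only [Set.mem_preimage] at hz
      rw [Set.uIcc_of_le (by linarith)] at hz
      exact hz.2
    · rintro z ⟨-, hz⟩
      simp only [Set.mem_preimage] at hz
      rw [max_eq_right (by linarith)] at hz
      exact hz.2
  have hlim : Tendsto D atTop (𝓝 ((∫ x : ℝ, Φ (↑x + ↑(-T) * Complex.I)) - ∫ x : ℝ, Φ x)) :=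
    (intervalIntegral_tendsto_integral h1 tendsto_neg_atTop_atBot tendsto_id).sub
      (intervalIntegral_tendsto_integral h0 tendsto_neg_atTop_atBot tendsto_id)
  by_contra hne
  have hpos : 0 < ‖(∫ x : ℝ, Φ (↑x + ↑(-T) * Complex.I)) - ∫ x : ℝ, Φ x‖ₑ := by
    simpa [enorm_pos, sub_eq_zero] using hne
  obtain ⟨c, hc0, hcl⟩ := exists_between hpos
  have hev : ∀ᶠ R in atTop, c < ‖D R‖ₑ := hlim.enorm.eventually (lt_mem_nhds hcl)
  obtain ⟨R₀, hR₀⟩ := eventually_atTop.1 (hev.and (eventually_ge_atTop 0))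
  apply hsum
  rw [eq_top_iff]
  calc (⊤ : ℝ≥0∞) = ∫⁻ _ in Set.Ici R₀, c := by
        rw [setLIntegral_const, Real.volume_Ici, ENNReal.mul_top hc0.ne']
    _ ≤ ∫⁻ x in Set.Ici R₀, (a x + a (-x)) :=
        setLIntegral_mono' measurableSet_Ici fun x hx =>
          (hR₀ x hx).1.le.trans (hDb x (hR₀ x hx).2)
    _ ≤ _ := setLIntegral_le_lintegral _ _

/-- A function analytic in the lower half-plane whose `L¹` norms on horizontal lines are bounded
and tend to zero has vanishing integral over the real axis. -/
theorem integral_eq_zero_of_lintegral_horizontal_tendsto {Φ : ℂ → ℂ}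
    (hd : DifferentiableOn ℂ Φ {z : ℂ | z.im < 0})
    (hc : ContinuousOn Φ {z : ℂ | z.im ≤ 0})
    (h0 : Integrable fun x : ℝ => Φ x)
    {N : ℝ → ℝ≥0∞} {K : ℝ≥0∞} (hK : K ≠ ⊤) (hNK : ∀ y, N y ≤ K) (hN : Tendsto N atBot (𝓝 0))
    (hb : ∀ y : ℝ, y < 0 → ∫⁻ x : ℝ, ‖Φ (↑x + ↑y * Complex.I)‖ₑ ≤ N y) :
    ∫ x : ℝ, Φ x = 0 := by
  have key : ∀ y : ℝ, y < 0 → ‖∫ x : ℝ, Φ x‖ₑ ≤ N y := fun y hy => by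
    have h1 : Integrable fun x : ℝ => Φ (↑x + ↑y * Complex.I) := by
      refine ⟨Continuous.aestronglyMeasurable ?_, ((hb y hy).trans (hNK y)).trans_lt hK.lt_top⟩
      refine hc.comp_continuous (by fun_prop) fun x => ?_
      simpa using hy.le
    have h := integral_horizontal_eq_of_lintegral_strip (T := -y) (by linarith) hd hc h0
      (by simpa using h1) hK fun y hy => (hb y hy).trans (hNK y)
    rw [← h, neg_neg]
    exact (enorm_integral_le_lintegral_enorm _).trans (hb y hy)
  have : ‖∫ x : ℝ, Φ x‖ₑ ≤ 0 :=
    ge_of_tendsto hN ((eventually_lt_atBot 0).mono key)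
  simpa using this

theorem one_add_norm_le_mul_norm_sub {η : ℝ} (hη : 0 < η) {z b : ℂ} (h : η ≤ ‖z - b‖) :
    1 + ‖z‖ ≤ (1 + (1 + ‖b‖) / η) * ‖z - b‖ := by
  have h1 : ‖z‖ ≤ ‖z - b‖ + ‖b‖ := by simpa using norm_add_le (z - b) b
  have h2 : (1 + ‖b‖) / η * η ≤ (1 + ‖b‖) / η * ‖z - b‖ := by gcongr
  rw [div_mul_cancel₀ _ hη.ne'] at h2
  linarith

theorem integral_sub_conj_div (a : ℂ) (ha : a.im < 0) :
    ∫ x : ℝ, (a - star a) / (↑x - star a) / (↑x - a) = -(2 * Real.pi * Complex.I) := by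
  have hη : a.im ≠ 0 := ha.ne
  have h : ∀ x : ℝ, (a - star a) / (↑x - star a) / (↑x - a)
      = (2 / a.im * Complex.I) * (((1 + ((x - a.re) / a.im) ^ 2)⁻¹ : ℝ) : ℂ) := fun x => by
    have h1 : (↑x - a) ≠ 0 := fun h => by
      have := congrArg Complex.im h
      simp at this
      exact hη this
    have h2 : (↑x - star a) ≠ 0 := fun h => by
      have := congrArg Complex.im h
      simp at this
      exact hη this
    have h3 : ((a.im : ℝ) : ℂ) ≠ 0 := by exact_mod_cast hη
    have h4 : (1 + ((x - a.re) / a.im) ^ 2 : ℂ) ≠ 0 := by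
      have : (1 + ((x - a.re) / a.im) ^ 2 : ℝ) ≠ 0 := by positivity
      exact_mod_cast this
    have h5 : a - star a = 2 * a.im * Complex.I := by
      apply Complex.ext <;> simp
      ring
    have h6 : (↑x - star a) * (↑x - a) = (x - a.re) ^ 2 + a.im ^ 2 := by
      apply Complex.ext <;> simp [pow_two]
      ring
    rw [div_div, h5, h6]
    push_cast
    have h7 : ((x : ℂ) - a.re) ^ 2 + a.im ^ 2 ≠ 0 := by rw [← h6]; exact mul_ne_zero h2 h1
    rw [add_comm] at h7
    field_simp
    rw [add_comm (((x : ℂ) - a.re) ^ 2), div_self h7]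
  simp_rw [h]
  rw [integral_const_mul, integral_complex_ofReal, integral_sub_right_eq_self
    (fun x : ℝ => (1 + (x / a.im) ^ 2)⁻¹), Measure.integral_comp_div
    (fun x : ℝ => (1 + x ^ 2)⁻¹), integral_univ_inv_one_add_sq, abs_of_neg ha]
  have h3 : ((a.im : ℝ) : ℂ) ≠ 0 := by exact_mod_cast hη
  simp only [smul_eq_mul]
  push_cast
  field_simp

/-- A function dominated by `(‖g‖ ^ 2 + 1) / (1 + ‖z‖) ^ 2` with `g` of Hardy class has
vanishing integral over the real axis. -/
theorem HardyBelow.integral_eq_zero_of_norm_le {g Φ : ℂ → ℂ} (hg : HardyBelow 2 g)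
    (hd : DifferentiableOn ℂ Φ {z : ℂ | z.im < 0})
    (hc : ContinuousOn Φ {z : ℂ | z.im ≤ 0})
    (h0 : Integrable fun x : ℝ => Φ x) {C : ℝ} (hC : 0 ≤ C)
    (hb : ∀ z : ℂ, z.im < 0 → ‖Φ z‖ ≤ C * (‖g z‖ ^ 2 + 1) / (1 + ‖z‖) ^ 2) :
    ∫ x : ℝ, Φ x = 0 := by
  obtain ⟨-, -, M, hM⟩ := hg
  simp only [Real.rpow_two] at hM
  have hk : Integrable fun x : ℝ => (1 + ‖x‖ ^ 2) ^ (-(3 / 2 : ℝ) / 2) :=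
    integrable_rpow_neg_one_add_norm_sq (by norm_num)
  set k : ℝ → ℝ := fun x => (1 + ‖x‖ ^ 2) ^ (-(3 / 2 : ℝ) / 2) with hkdef
  have hk0 : ∀ x, 0 ≤ k x := fun x => by positivity
  have hM0 : 0 ≤ M := (integral_nonneg fun x => by positivity).trans (hM (-1) (by norm_num)).2
  set B : ℝ := C * (M + ∫ x, k x)
  have hB : 0 ≤ B := mul_nonneg hC (add_nonneg hM0 (integral_nonneg hk0))
  refine integral_eq_zero_of_lintegral_horizontal_tendsto hd hc h0
    (N := fun y => ENNReal.ofReal (B * (1 + y ^ 2) ^ (-(1 / 4) : ℝ))) (K := ENNReal.ofReal B)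
    ENNReal.ofReal_ne_top ?_ ?_ ?_
  · intro y
    refine ENNReal.ofReal_le_ofReal (mul_le_of_le_one_right hB ?_)
    exact Real.rpow_le_one_of_one_le_of_nonpos (by nlinarith) (by norm_num)
  · have h1 : Tendsto (fun y : ℝ => 1 + y ^ 2) atBot atTop :=
      tendsto_atTop_add_const_left _ _ (by
        simpa [Function.comp_def] using
          (tendsto_pow_atTop (α := ℝ) two_ne_zero).comp tendsto_abs_atBot_atTop)
    have h2 := (((tendsto_rpow_neg_atTop (y := 1 / 4) (by norm_num)).comp h1).const_mul B)
    rw [mul_zero] at h2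
    simpa using ENNReal.tendsto_ofReal h2
  · intro y hy
    set m : ℝ := (1 + y ^ 2) ^ (-(1 / 4) : ℝ)
    have hm : 0 ≤ m := by positivity
    have hpt : ∀ x : ℝ, ‖Φ (↑x + ↑y * Complex.I)‖
        ≤ C * m * (‖g (↑x + ↑y * Complex.I)‖ ^ 2 + k x) := fun x => by
      set z : ℂ := ↑x + ↑y * Complex.I with hz
      have hzn : ‖z‖ ^ 2 = x ^ 2 + y ^ 2 := by
        rw [Complex.sq_norm, Complex.normSq_apply]
        simp [hz, pow_two]
      set S : ℝ := (1 + ‖z‖) ^ 2 with hS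
      have hSy : 1 + y ^ 2 ≤ S := by nlinarith [norm_nonneg z]
      have hSx : 1 + ‖x‖ ^ 2 ≤ S := by
        rw [Real.norm_eq_abs, sq_abs]
        nlinarith [norm_nonneg z]
      have hS1 : 1 ≤ S := by nlinarith
      have hS0 : 0 < S := by linarith
      have hSm : S ^ (-(1 / 4) : ℝ) ≤ m :=
        Real.rpow_le_rpow_of_nonpos (by positivity) hSy (by norm_num)
      have hSk : S ^ (-(3 / 2 : ℝ) / 2) ≤ k x :=
        Real.rpow_le_rpow_of_nonpos (by positivity) hSx (by norm_num)
      have hinv : S⁻¹ = S ^ (-(1 / 4) : ℝ) * S ^ (-(3 / 2 : ℝ) / 2) := by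
        rw [← Real.rpow_add hS0, ← Real.rpow_neg_one]
        norm_num
      have hSk1 : S ^ (-(3 / 2 : ℝ) / 2) ≤ 1 :=
        Real.rpow_le_one_of_one_le_of_nonpos hS1 (by norm_num)
      have hi1 : S⁻¹ ≤ m := by
        rw [hinv]
        exact (mul_le_of_le_one_right (by positivity) hSk1).trans hSm
      have hi2 : S⁻¹ ≤ m * k x := by
        rw [hinv]
        gcongr
      calc ‖Φ z‖ ≤ C * (‖g z‖ ^ 2 + 1) / S := hb z (by simpa [hz] using hy)
        _ = C * (‖g z‖ ^ 2 * S⁻¹ + S⁻¹) := by ring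
        _ ≤ C * (‖g z‖ ^ 2 * m + m * k x) := by gcongr
        _ = _ := by ring
    have hint : Integrable fun x : ℝ =>
        C * m * (‖g (↑x + ↑y * Complex.I)‖ ^ 2 + k x) := ((hM y hy).1.add hk).const_mul _
    calc ∫⁻ x : ℝ, ‖Φ (↑x + ↑y * Complex.I)‖ₑ
        ≤ ∫⁻ x : ℝ, ENNReal.ofReal (C * m * (‖g (↑x + ↑y * Complex.I)‖ ^ 2 + k x)) :=
          lintegral_mono fun x => by
            rw [← ofReal_norm]
            exact ENNReal.ofReal_le_ofReal (hpt x)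
      _ = ENNReal.ofReal (∫ x : ℝ, C * m * (‖g (↑x + ↑y * Complex.I)‖ ^ 2 + k x)) :=
          (ofReal_integral_eq_lintegral_ofReal hint (ae_of_all _ fun x => by
            have := hk0 x
            positivity)).symm
      _ ≤ ENNReal.ofReal (B * m) := by
          refine ENNReal.ofReal_le_ofReal ?_
          rw [integral_const_mul, integral_add (hM y hy).1 hk]
          calc C * m * ((∫ x : ℝ, ‖g (↑x + ↑y * Complex.I)‖ ^ 2) + ∫ x, k x)
              ≤ C * m * (M + ∫ x, k x) := by gcongr; exact (hM y hy).2
            _ = B * m := by ring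

/-- Cauchy's formula over the real axis for functions analytic in the lower half-plane. -/
theorem HardyBelow.integral_div_sub {g P : ℂ → ℂ} (hg : HardyBelow 2 g)
    {A : ℝ} (hgA : ∀ x : ℝ, ‖g x‖ ≤ A)
    (hd : DifferentiableOn ℂ P {z : ℂ | z.im < 0})
    (hc : ContinuousOn P {z : ℂ | z.im ≤ 0}) {C : ℝ} (hC : 0 ≤ C)
    (hP : ∀ z : ℂ, z.im ≤ 0 → ‖P z‖ ≤ C * (‖g z‖ ^ 2 + 1) / (1 + ‖z‖))
    {a : ℂ} (ha : a.im < 0) :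
    ∫ x : ℝ, P x / (↑x - a) = -(2 * Real.pi * Complex.I) * P a := by
  have hη : 0 < -a.im := by linarith
  have hconj : ∀ z : ℂ, z.im ≤ 0 → -a.im ≤ ‖z - star a‖ := fun z hz => by
    refine le_trans ?_ (Complex.abs_im_le_norm _)
    refine le_trans ?_ (neg_le_abs _)
    simp
    exact hz
  have hreal : ∀ x : ℝ, -a.im ≤ ‖(x : ℂ) - a‖ := fun x => by
    refine le_trans ?_ (Complex.abs_im_le_norm _)
    refine le_trans ?_ (le_abs_self _)
    simp
  have hconj0 : ∀ z : ℂ, z.im ≤ 0 → z - star a ≠ 0 := fun z hz =>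
    norm_pos_iff.1 (hη.trans_le (hconj z hz))
  have hreal0 : ∀ x : ℝ, (x : ℂ) - a ≠ 0 := fun x => norm_pos_iff.1 (hη.trans_le (hreal x))
  set q : ℂ → ℂ := fun z => (a - star a) / (z - star a) with hq
  set H : ℂ → ℂ := fun z => P z - P a * q z with hH
  have hqa : q a = 1 := div_self (hconj0 a ha.le)
  have hHa : H a = 0 := by simp [hH, hqa]
  have hHd : DifferentiableOn ℂ H {z : ℂ | z.im < 0} :=
    hd.sub (((differentiableOn_const _).div (by fun_prop) fun z hz =>
      hconj0 z (le_of_lt hz)).const_mul _)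
  have hHc : ContinuousOn H {z : ℂ | z.im ≤ 0} :=
    hc.sub (continuousOn_const.mul (continuousOn_const.div (by fun_prop) hconj0))
  have hopen : IsOpen {z : ℂ | z.im < 0} := isOpen_lt Complex.continuous_im continuous_const
  have hclosed : IsClosed {z : ℂ | z.im ≤ 0} := isClosed_le Complex.continuous_im continuous_const
  have hnhds : {z : ℂ | z.im < 0} ∈ 𝓝 a := hopen.mem_nhds ha
  have hΦd : DifferentiableOn ℂ (dslope H a) {z : ℂ | z.im < 0} :=
    (Complex.differentiableOn_dslope hnhds).2 hHd
  have hΦc : ContinuousOn (dslope H a) {z : ℂ | z.im ≤ 0} :=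
    (continuousOn_dslope (s := {z : ℂ | z.im ≤ 0})
      (mem_of_superset hnhds fun z (hz : z.im < 0) => hz.le)).2
      ⟨hHc, hHd.differentiableAt hnhds⟩
  have hΦ : ∀ z, z ≠ a → dslope H a z = H z / (z - a) := fun z hz => by
    rw [dslope_of_ne _ hz, slope_def_field, hHa, sub_zero]
  set c₁ : ℝ := 1 + (1 + ‖star a‖) / (-a.im)
  set C₁ : ℝ := C + ‖P a‖ * (‖a - star a‖ * c₁)
  have hC₁ : 0 ≤ C₁ := by positivity
  have hqb : ∀ z : ℂ, z.im ≤ 0 → ‖q z‖ ≤ ‖a - star a‖ * c₁ / (1 + ‖z‖) := fun z hz => by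
    have h1 := one_add_norm_le_mul_norm_sub hη (hconj z hz)
    have h2 := hη.trans_le (hconj z hz)
    rw [hq, norm_div, div_le_div_iff₀ h2 (by positivity), mul_assoc]
    gcongr
  have hHb : ∀ z : ℂ, z.im ≤ 0 → ‖H z‖ ≤ C₁ * (‖g z‖ ^ 2 + 1) / (1 + ‖z‖) := fun z hz => by
    calc ‖H z‖ ≤ ‖P z‖ + ‖P a‖ * ‖q z‖ := (norm_sub_le _ _).trans_eq (by rw [norm_mul])
      _ ≤ C * (‖g z‖ ^ 2 + 1) / (1 + ‖z‖)
          + ‖P a‖ * (‖a - star a‖ * c₁ * (‖g z‖ ^ 2 + 1) / (1 + ‖z‖)) := by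
          gcongr
          · exact hP z hz
          · refine (hqb z hz).trans ?_
            refine div_le_div_of_nonneg_right ?_ (by positivity)
            exact le_mul_of_one_le_right (by positivity) (by nlinarith [norm_nonneg (g z)])
      _ = _ := by ring
  obtain ⟨B, hB⟩ := ((isCompact_closedBall a 1).inter_right hclosed).exists_bound_of_continuousOn
    (hΦc.mono Set.inter_subset_right)
  have hB0 : 0 ≤ B := (norm_nonneg _).trans (hB a ⟨by simp, ha.le⟩)
  set C₂ : ℝ := C₁ * (1 + (1 + ‖a‖) / 1) + B * (2 + ‖a‖) ^ 2
  have hC₂ : 0 ≤ C₂ := by positivity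
  have hΦb : ∀ z : ℂ, z.im ≤ 0 →
      ‖dslope H a z‖ ≤ C₂ * (‖g z‖ ^ 2 + 1) / (1 + ‖z‖) ^ 2 := fun z hz => by
    rw [le_div_iff₀ (by positivity)]
    rcases le_total ‖z - a‖ 1 with h | h
    · have h1 : ‖dslope H a z‖ ≤ B := hB z ⟨by simpa [dist_eq_norm] using h, hz⟩
      have h2 : ‖z‖ ≤ 1 + ‖a‖ := by
        have := norm_add_le (z - a) a
        simp at this
        linarith
      calc ‖dslope H a z‖ * (1 + ‖z‖) ^ 2 ≤ B * (2 + ‖a‖) ^ 2 := by gcongr ?_ * ?_ ^ 2; linarith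
        _ ≤ C₂ := le_add_of_nonneg_left (by positivity)
        _ ≤ _ := le_mul_of_one_le_right hC₂ (by nlinarith [norm_nonneg (g z)])
    · have h0 : 0 < ‖z - a‖ := by linarith
      rw [hΦ z (sub_ne_zero.1 (norm_pos_iff.1 h0)), norm_div]
      have h1 := one_add_norm_le_mul_norm_sub one_pos h
      have h2 := hHb z hz
      rw [le_div_iff₀ (by positivity)] at h2
      calc ‖H z‖ / ‖z - a‖ * (1 + ‖z‖) ^ 2
          = ‖H z‖ * (1 + ‖z‖) * (1 + ‖z‖) / ‖z - a‖ := by ring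
        _ ≤ C₁ * (‖g z‖ ^ 2 + 1) * ((1 + (1 + ‖a‖) / 1) * ‖z - a‖) / ‖z - a‖ := by gcongr
        _ = C₁ * (1 + (1 + ‖a‖) / 1) * (‖g z‖ ^ 2 + 1) := by field_simp
        _ ≤ _ := by
          gcongr
          exact le_add_of_nonneg_right (by positivity)
  have hreal_int : ∀ {f : ℝ → ℂ} {K : ℝ}, Continuous f →
      (∀ x, ‖f x‖ ≤ K / (1 + ‖(x : ℂ)‖) ^ 2) → Integrable f := by
    intro f K hf hK
    refine (integrable_inv_one_add_sq.const_mul |K|).mono' hf.aestronglyMeasurable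
      (ae_of_all _ fun x => (hK x).trans ?_)
    rw [div_eq_mul_inv]
    gcongr
    · exact le_abs_self K
    · rw [Complex.norm_real, Real.norm_eq_abs]
      nlinarith [sq_abs x, abs_nonneg x]
  have hΦint : Integrable fun x : ℝ => dslope H a x := by
    refine hreal_int (K := C₂ * (A ^ 2 + 1))
      (hΦc.comp_continuous (by fun_prop) fun x => by simp) fun x => ?_
    refine (hΦb x (by simp)).trans ?_
    gcongr
    exact hgA x
  have hqint : Integrable fun x : ℝ => q x / (↑x - a) := by
    refine hreal_int (K := ‖a - star a‖ * c₁ * (1 + (1 + ‖a‖) / (-a.im))) ?_ fun x => ?_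
    · have hqc : Continuous fun x : ℝ => q x :=
        continuous_const.div (by fun_prop) fun x => hconj0 x (by simp)
      exact hqc.div (by fun_prop) hreal0
    · have h1 := hqb x (by simp)
      have h2 := one_add_norm_le_mul_norm_sub hη (hreal x)
      have h3 := hη.trans_le (hreal x)
      rw [le_div_iff₀ (by positivity)] at h1
      rw [norm_div, le_div_iff₀ (by positivity), div_mul_eq_mul_div, div_le_iff₀ h3]
      calc ‖q x‖ * (1 + ‖(x : ℂ)‖) ^ 2 = ‖q x‖ * (1 + ‖(x : ℂ)‖) * (1 + ‖(x : ℂ)‖) := by ring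
        _ ≤ ‖a - star a‖ * c₁ * ((1 + (1 + ‖a‖) / (-a.im)) * ‖(x : ℂ) - a‖) := by gcongr
        _ = _ := by ring
  have hzero := hg.integral_eq_zero_of_norm_le hΦd hΦc hΦint hC₂ fun z hz => hΦb z (le_of_lt hz)
  have hsplit : ∀ x : ℝ, P x / (↑x - a) = dslope H a x + P a * (q x / (↑x - a)) := fun x => by
    rw [hΦ x (sub_ne_zero.1 (hreal0 x))]
    simp only [hH]
    ring
  simp_rw [hsplit]
  rw [integral_add hΦint (hqint.const_mul _), hzero, integral_const_mul,
    integral_sub_conj_div a ha, zero_add, mul_comm]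

/-- The branch of the square root on the closed lower half-plane with argument in `[-π, 0]`. -/
noncomputable def lowerSqrt (z : ℂ) : ℂ :=
  Complex.exp (-(Real.pi / 4) * Complex.I) * (Complex.I * z) ^ ((1 : ℂ) / 2)

theorem continuousOn_lowerSqrt : ContinuousOn lowerSqrt {z : ℂ | z.im ≤ 0} := by
  intro z hz
  have h : ContinuousAt (fun x : ℂ => x ^ ((1 : ℂ) / 2)) (Complex.I * z) :=
    Complex.continuousAt_cpow_const_of_re_pos (Or.inl (by simpa using hz)) (by norm_num)
  have h2 : ContinuousAt (fun z : ℂ => Complex.I * z) z := by fun_prop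
  exact (continuousAt_const.mul (ContinuousAt.comp (f := fun z : ℂ => Complex.I * z)
    h h2)).continuousWithinAt

theorem differentiableOn_lowerSqrt : DifferentiableOn ℂ lowerSqrt {z : ℂ | z.im < 0} := by
  intro z hz
  have h : DifferentiableAt ℂ (fun z : ℂ => (Complex.I * z) ^ ((1 : ℂ) / 2)) z :=
    DifferentiableAt.cpow (by fun_prop) (by fun_prop) (Or.inl (by simpa using hz))
  exact (h.const_mul _).differentiableWithinAt

theorem norm_lowerSqrt_sq (z : ℂ) : ‖lowerSqrt z‖ ^ 2 = ‖z‖ := by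
  have h : ((Complex.I * z) ^ ((1 : ℂ) / 2)) ^ 2 = Complex.I * z := by
    simp
  have h2 : ‖Complex.exp (-(Real.pi / 4) * Complex.I)‖ = 1 := by
    exact_mod_cast Complex.norm_exp_ofReal_mul_I (-(Real.pi / 4))
  rw [lowerSqrt, norm_mul, h2, one_mul, ← norm_pow, h, norm_mul, Complex.norm_I, one_mul]

theorem norm_lowerSqrt_le (z : ℂ) : ‖lowerSqrt z‖ ≤ 1 + ‖z‖ := by
  nlinarith [norm_lowerSqrt_sq z, sq_nonneg (‖lowerSqrt z‖ - 1), norm_nonneg (lowerSqrt z)]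

theorem lowerSqrt_of_im_neg {z : ℂ} (hz : z.im < 0) : lowerSqrt z = z ^ ((1 : ℂ) / 2) := by
  have hz0 : z ≠ 0 := by
    rintro rfl
    simp at hz
  have h1 := Complex.arg_neg_iff.2 hz
  have h2 := Complex.neg_pi_lt_arg z
  have hlog : Complex.log (Complex.I * z) = Complex.log Complex.I + Complex.log z :=
    Complex.log_mul Complex.I_ne_zero hz0 (by
      rw [Complex.arg_I]
      constructor <;> linarith [Real.pi_pos])
  rw [lowerSqrt, Complex.cpow_def_of_ne_zero (mul_ne_zero Complex.I_ne_zero hz0),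
    Complex.cpow_def_of_ne_zero hz0, hlog, Complex.log_I, ← Complex.exp_add]
  congr 1
  ring

theorem lowerSqrt_ofReal (t : ℝ) : lowerSqrt t =
    if 0 ≤ t then (↑(Real.sqrt t) : ℂ) else -Complex.I * ↑(Real.sqrt (-t)) := by
  have hsqrt : ∀ r : ℝ, 0 ≤ r → (r : ℂ) ^ ((1 : ℂ) / 2) = ↑(Real.sqrt r) := fun r hr => by
    rw [Real.sqrt_eq_rpow, Complex.ofReal_cpow hr]
    simp
  have hmul : ∀ (r : ℝ) (u : ℂ), 0 < r → u ≠ 0 →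
      (↑r * u) ^ ((1 : ℂ) / 2) = ↑(Real.sqrt r) * Complex.exp (Complex.log u / 2) := by
    intro r u hr hu
    have hr' : (r : ℂ) ≠ 0 := by exact_mod_cast hr.ne'
    rw [← hsqrt r hr.le, Complex.cpow_def_of_ne_zero (mul_ne_zero hr' hu),
      Complex.cpow_def_of_ne_zero hr', Complex.log_ofReal_mul hr hu, Complex.ofReal_log hr.le,
      ← Complex.exp_add]
    congr 1
    ring
  rcases lt_trichotomy t 0 with ht | rfl | ht
  · rw [if_neg ht.not_ge, lowerSqrt, show Complex.I * (t : ℂ) = ↑(-t) * -Complex.I by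
      push_cast; ring, hmul _ _ (neg_pos.2 ht) (neg_ne_zero.2 Complex.I_ne_zero),
      Complex.log_neg_I, mul_left_comm, ← Complex.exp_add,
      show -(Real.pi / 4 : ℂ) * Complex.I + -(Real.pi / 2) * Complex.I / 2
        = -(Real.pi / 2 * Complex.I) by ring, Complex.exp_neg, Complex.exp_pi_div_two_mul_I,
      Complex.inv_I, mul_comm]
  · simp [lowerSqrt]
  · rw [if_pos ht.le, lowerSqrt, mul_comm Complex.I, hmul _ _ ht Complex.I_ne_zero,
      Complex.log_I, mul_left_comm, ← Complex.exp_add,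
      show -(Real.pi / 4 : ℂ) * Complex.I + Real.pi / 2 * Complex.I / 2 = 0 by ring,
      Complex.exp_zero, mul_one]

theorem one_add_sq_le_norm_sq_damping {ε : ℝ} (hε : 0 ≤ ε) {z : ℂ} (hz : z.im ≤ 0) :
    1 + ε ^ 2 * ‖z‖ ^ 2 ≤ ‖1 + ε * Complex.I * z‖ ^ 2 := by
  rw [Complex.sq_norm, Complex.sq_norm, Complex.normSq_apply, Complex.normSq_apply]
  simp
  nlinarith [mul_nonneg hε (neg_nonneg.2 hz)]

/-- The eigenvalue identity with the integrand damped by `(1 + iεz)⁻²`. -/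
theorem HardyBelow.integral_lowerSqrt_damped {g : ℂ → ℂ} (hg : HardyBelow 2 g)
    {A : ℝ} (hgA : ∀ x : ℝ, ‖g x‖ ≤ A) {ε : ℝ} (hε : 0 < ε) (hε1 : ε ≤ 1)
    {a : ℂ} (ha : a.im < 0) :
    ∫ x : ℝ, lowerSqrt x * g x / (1 + ε * Complex.I * x) ^ 2 / (↑x - a) =
      -(2 * Real.pi * Complex.I) * (lowerSqrt a * g a / (1 + ε * Complex.I * a) ^ 2) := by
  have hden : ∀ z : ℂ, z.im ≤ 0 → (1 + ε * Complex.I * z) ^ 2 ≠ 0 := fun z hz => by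
    rw [← norm_pos_iff, norm_pow]
    exact lt_of_lt_of_le (by positivity) (one_add_sq_le_norm_sq_damping hε.le hz)
  refine hg.integral_div_sub (P := fun z => lowerSqrt z * g z / (1 + ε * Complex.I * z) ^ 2)
    (C := 2 / ε ^ 2) hgA ?_ ?_ (by positivity) (fun z hz => ?_) ha
  · exact (differentiableOn_lowerSqrt.mul hg.1).div (by fun_prop) fun z hz => hden z (le_of_lt hz)
  · exact (continuousOn_lowerSqrt.mul hg.2.1).div (by fun_prop) hden
  · have h1 := one_add_sq_le_norm_sq_damping hε.le hz
    have h0 : 0 < 1 + ε ^ 2 * ‖z‖ ^ 2 := by positivity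
    have h2 : (1 + ‖z‖) ^ 2 ≤ 2 / ε ^ 2 * (1 + ε ^ 2 * ‖z‖ ^ 2) := by
      rw [div_mul_eq_mul_div, le_div_iff₀ (by positivity)]
      have : ε ^ 2 ≤ 1 := pow_le_one₀ hε.le hε1
      nlinarith [mul_nonneg (sq_nonneg ε) (sq_nonneg (‖z‖ - 1))]
    rw [norm_div, norm_mul, norm_pow, div_le_div_iff₀ (h0.trans_le h1) (by positivity)]
    calc ‖lowerSqrt z‖ * ‖g z‖ * (1 + ‖z‖)
        ≤ (1 + ‖z‖) * (‖g z‖ ^ 2 + 1) * (1 + ‖z‖) := by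
          gcongr
          · exact norm_lowerSqrt_le z
          · nlinarith [sq_nonneg (‖g z‖ - 1), norm_nonneg (g z)]
      _ = (‖g z‖ ^ 2 + 1) * (1 + ‖z‖) ^ 2 := by ring
      _ ≤ (‖g z‖ ^ 2 + 1) * (2 / ε ^ 2 * (1 + ε ^ 2 * ‖z‖ ^ 2)) := by gcongr
      _ ≤ (‖g z‖ ^ 2 + 1) * (2 / ε ^ 2 * ‖1 + ε * Complex.I * z‖ ^ 2) := by gcongr
      _ = _ := by ring

/-- Generalized eigenvalue identity for the mass operator: with `w` the boundary
value from below of the branch of the square root with argument in `[-π, π)`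
(so `w(t) = √t` for `t ≥ 0` and `w(t) = -i√(-t)` for `t < 0`), and with
`z_R^(1/2)` the square root of `z_R` lying in the lower half-plane (argument in
`(-π/2, 0)`; this is the principal complex power since `Im z_R < 0`), one has
`∫ w(t) g(t)/(t - z_R) dt = -2πi √z_R g(z_R)`. -/
theorem hardyBelow_mass_eigenvalue (g : ℂ → ℂ) (hg : HardyBelow 2 g)
    (hgS : ∃ ψ : SchwartzMap ℝ ℂ, ∀ x : ℝ, g ↑x = ψ x)
    (zR : ℂ) (hzR : zR.im < 0)
    (w : ℝ → ℂ)
    (hw : ∀ t : ℝ, w t = if 0 ≤ t then (↑(Real.sqrt t) : ℂ)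
      else -Complex.I * ↑(Real.sqrt (-t))) :
    ∫ t : ℝ, w t * g ↑t / (↑t - zR) =
      -(2 * Real.pi * Complex.I) * (zR ^ ((1 : ℂ) / 2) * g zR) := by
  obtain ⟨ψ, hψ⟩ := hgS
  obtain ⟨A, -, hA⟩ := ψ.decay 0 0
  have hgA : ∀ x : ℝ, ‖g x‖ ≤ A := fun x => by simpa [hψ] using hA x
  have hη : 0 < -zR.im := by linarith
  have hreal : ∀ x : ℝ, -zR.im ≤ ‖(x : ℂ) - zR‖ := fun x => by
    refine le_trans ?_ (Complex.abs_im_le_norm _)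
    refine le_trans ?_ (le_abs_self _)
    simp
  have hreal0 : ∀ x : ℝ, (x : ℂ) - zR ≠ 0 := fun x => norm_pos_iff.1 (hη.trans_le (hreal x))
  have hcs : Continuous fun x : ℝ => lowerSqrt x :=
    continuousOn_lowerSqrt.comp_continuous (by fun_prop) fun x => by simp
  have hcg : Continuous fun x : ℝ => g x := by simpa only [hψ] using ψ.continuous
  set ε : ℕ → ℝ := fun n => 1 / ((n : ℝ) + 1) with hεdef
  have hε : ∀ n, 0 < ε n := fun n => by positivity
  have hε1 : ∀ n, ε n ≤ 1 := fun n =>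
    div_le_one_of_le₀ (by linarith [(n.cast_nonneg : (0 : ℝ) ≤ n)]) (by positivity)
  have hε0 : Tendsto (fun n => (ε n : ℂ)) atTop (𝓝 0) := by
    rw [← Complex.ofReal_zero]
    exact (Complex.continuous_ofReal.tendsto 0).comp
      (tendsto_one_div_add_atTop_nhds_zero_nat (𝕜 := ℝ))
  have hlim : ∀ u z : ℂ,
      Tendsto (fun n => u / (1 + ε n * Complex.I * z) ^ 2) atTop (𝓝 u) := fun u z => by
    have h := (((hε0.mul_const Complex.I).mul_const z).const_add 1).pow 2
    have h' := (tendsto_const_nhds (x := u)).div h (by simp)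
    simpa [Pi.div_def] using h'
  have hden : ∀ (n : ℕ) (x : ℝ), 1 ≤ ‖(1 + ε n * Complex.I * (x : ℂ)) ^ 2‖ := fun n x => by
    rw [norm_pow]
    refine le_trans ?_ (one_add_sq_le_norm_sq_damping (hε n).le (by simp))
    exact le_add_of_nonneg_right (by positivity)
  have hL : Tendsto (fun n => ∫ x : ℝ,
      lowerSqrt x * g x / (1 + ε n * Complex.I * x) ^ 2 / (↑x - zR)) atTop
      (𝓝 (∫ x : ℝ, lowerSqrt x * g x / (↑x - zR))) := by
    refine tendsto_integral_of_dominated_convergence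
      (fun x => (1 + (1 + ‖zR‖) / (-zR.im)) * ‖ψ x‖) (fun n => ?_)
      (ψ.integrable.norm.const_mul _) (fun n => ae_of_all _ fun x => ?_)
      (ae_of_all _ fun x => (hlim _ _).div_const _)
    · refine Continuous.aestronglyMeasurable ?_
      exact ((hcs.mul hcg).div (by fun_prop) fun x =>
        norm_pos_iff.1 (one_pos.trans_le (hden n x))).div (by fun_prop) hreal0
    · rw [norm_div, norm_div, norm_mul, div_le_iff₀ (hη.trans_le (hreal x))]
      calc ‖lowerSqrt x‖ * ‖g x‖ / ‖(1 + ε n * Complex.I * (x : ℂ)) ^ 2‖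
          ≤ ‖lowerSqrt x‖ * ‖g x‖ := div_le_self (by positivity) (hden n x)
        _ ≤ (1 + (1 + ‖zR‖) / (-zR.im)) * ‖(x : ℂ) - zR‖ * ‖ψ x‖ := by
          rw [hψ]
          gcongr
          exact (norm_lowerSqrt_le _).trans (one_add_norm_le_mul_norm_sub hη (hreal x))
        _ = _ := by ring
  have hR := (hlim (lowerSqrt zR * g zR) zR).const_mul (-(2 * Real.pi * Complex.I))
  have hw' : ∀ t : ℝ, w t = lowerSqrt t := fun t => by rw [hw, lowerSqrt_ofReal]
  simp_rw [hw']
  rw [← lowerSqrt_of_im_neg hzR]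
  refine tendsto_nhds_unique hL (hR.congr fun n => ?_)
  exact (hg.integral_lowerSqrt_damped hgA (hε n) (hε1 n) hzR).symm
end

section
/- Let F and G each be Hardy class from above of order 2, and suppose F(x) = G(x) for all x ≥ 0. Then F = G on the entire closed upper half-plane. (Uniqueness part of van Winter's theorem: a Hardy class function on the upper half-plane is uniquely determined by its boundary values on the positive real half-axis.) -/
open MeasureTheory Filter

/-- `f : ℂ → ℂ` is Hardy class from above of order `p`: analytic on the open upper
half-plane, continuous on the closed upper half-plane, and the `L^p` norms of the
horizontal sections `x ↦ f (x + iy)`, `y > 0`, are uniformly bounded. -/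
def HardyAbove (p : ℝ) (f : ℂ → ℂ) : Prop :=
  DifferentiableOn ℂ f {z : ℂ | 0 < z.im} ∧
  ContinuousOn f {z : ℂ | 0 ≤ z.im} ∧
  ∃ M : ℝ, ∀ y : ℝ, 0 < y →
    Integrable (fun x : ℝ => ‖f (↑x + ↑y * Complex.I)‖ ^ p) ∧
    ∫ x : ℝ, ‖f (↑x + ↑y * Complex.I)‖ ^ p ≤ M

/-- A function that is holomorphic on the upper half-plane, continuous up to the boundary and zero
on the positive real half-axis vanishes in the sector `0 < im c < re c`: the product of its four
rotates about `c` vanishes on the boundary of a square centred at `c`. -/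
theorem eq_zero_of_im_lt_re {f : ℂ → ℂ}
    (hd : DifferentiableOn ℂ f {z : ℂ | 0 < z.im}) (hc : ContinuousOn f {z : ℂ | 0 ≤ z.im})
    (h0 : ∀ x : ℝ, 0 ≤ x → f x = 0) {c : ℂ} (hpos : 0 < c.im) (hlt : c.im < c.re) :
    f c = 0 := by
  set s := c.im with hs
  have hne : -s ≠ s := by linarith
  set U : Set ℂ := Set.Ioo (-s) s ×ℂ Set.Ioo (-s) s with hU
  have hclU : closure U = Set.Icc (-s) s ×ℂ Set.Icc (-s) s := by
    rw [hU, Complex.closure_reProdIm, closure_Ioo hne]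
  have hUo : IsOpen U := isOpen_Ioo.reProdIm isOpen_Ioo
  have hUb : Bornology.IsBounded U :=
    (Metric.isBounded_Ioo _ _).reProdIm (Metric.isBounded_Ioo _ _)
  have rot (u : ℂ) (h1 : ∀ w ∈ U, -s < (u * w).im) (h2 : ∀ w ∈ closure U, -s ≤ (u * w).im) :
      DiffContOnCl ℂ (fun w ↦ f (c + u * w)) U := by
    refine ⟨hd.comp (by fun_prop) fun w hw ↦ ?_, hc.comp (by fun_prop) fun w hw ↦ ?_⟩
    · have := h1 w hw
      simp only [Set.mem_ofPred_eq, Complex.add_im]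
      linarith
    · have := h2 w hw
      simp only [Set.mem_ofPred_eq, Complex.add_im]
      linarith
  have vanish (u w : ℂ) (h1 : (u * w).im = -s) (h2 : -s ≤ (u * w).re) :
      f (c + u * w) = 0 := by
    have : c + u * w = ((c.re + (u * w).re : ℝ) : ℂ) := by
      apply Complex.ext
      · simp
      · rw [Complex.add_im, h1, Complex.ofReal_im, ← hs, add_neg_cancel]
    rw [this]
    exact h0 _ (by linarith)
  have hP : DiffContOnCl ℂ (fun w ↦ (f (c + 1 * w) * f (c + (-1) * w)) *
      (f (c + Complex.I * w) * f (c + (-Complex.I) * w))) U := by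
    have key : ∀ u : ℂ, u = 1 ∨ u = -1 ∨ u = Complex.I ∨ u = -Complex.I →
        DiffContOnCl ℂ (fun w ↦ f (c + u * w)) U := by
      intro u hu
      apply rot u
      · intro w hw
        simp only [hU, Complex.mem_reProdIm, Set.mem_Ioo] at hw
        rcases hu with rfl | rfl | rfl | rfl <;> simp <;> linarith
      · intro w hw
        rw [hclU] at hw
        simp only [Complex.mem_reProdIm, Set.mem_Icc] at hw
        rcases hu with rfl | rfl | rfl | rfl <;> simp <;> linarith
    have mul {p q : ℂ → ℂ} (hp : DiffContOnCl ℂ p U) (hq : DiffContOnCl ℂ q U) :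
        DiffContOnCl ℂ (fun w ↦ p w * q w) U :=
      ⟨hp.differentiableOn.mul hq.differentiableOn, hp.continuousOn.mul hq.continuousOn⟩
    exact mul (mul (key _ (by simp)) (key _ (by simp))) (mul (key _ (by simp)) (key _ (by simp)))
  have hfr : ∀ w ∈ frontier U, ‖(f (c + 1 * w) * f (c + (-1) * w)) *
      (f (c + Complex.I * w) * f (c + (-Complex.I) * w))‖ ≤ 0 := by
    intro w hw
    rw [hUo.frontier_eq, hclU] at hw
    obtain ⟨hw1, hw2⟩ := hw
    simp only [hU, Complex.mem_reProdIm, Set.mem_Icc, Set.mem_Ioo] at hw1 hw2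
    obtain ⟨⟨a1, a2⟩, b1, b2⟩ := hw1
    have hcases : w.im = -s ∨ w.im = s ∨ w.re = -s ∨ w.re = s := by
      by_contra! hcon
      exact hw2 ⟨⟨lt_of_le_of_ne a1 hcon.2.2.1.symm, lt_of_le_of_ne a2 hcon.2.2.2⟩,
        lt_of_le_of_ne b1 hcon.1.symm, lt_of_le_of_ne b2 hcon.2.1⟩
    rcases hcases with h | h | h | h
    · rw [vanish 1 w (by simp [h]) (by simpa using a1)]; simp
    · rw [vanish (-1) w (by simp [h]) (by simpa using a2)]; simp
    · rw [vanish Complex.I w (by simp [h]) (by simpa using b2)]; simp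
    · rw [vanish (-Complex.I) w (by simp [h]) (by simpa using b1)]; simp
  have hmem : (0 : ℂ) ∈ closure U := by
    rw [hclU]
    simp [Complex.mem_reProdIm, hpos.le]
  have := Complex.norm_le_of_forall_mem_frontier_norm_le hUb hP hfr hmem
  simpa only [norm_le_zero_iff, mul_zero, add_zero, mul_self_eq_zero] using this

/-- A function that is holomorphic on the upper half-plane, continuous up to the boundary and zero
on the nonnegative real half-axis vanishes on the closed upper half-plane. -/
theorem eq_zero_of_eq_zero_on_nonneg {f : ℂ → ℂ}
    (hd : DifferentiableOn ℂ f {z : ℂ | 0 < z.im}) (hc : ContinuousOn f {z : ℂ | 0 ≤ z.im})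
    (h0 : ∀ x : ℝ, 0 ≤ x → f x = 0) {z : ℂ} (hz : 0 ≤ z.im) : f z = 0 := by
  have hopen : IsOpen {z : ℂ | 0 < z.im} := isOpen_lt continuous_const Complex.continuous_im
  have hsector : IsOpen {z : ℂ | 0 < z.im ∧ z.im < z.re} :=
    hopen.inter (isOpen_lt Complex.continuous_im Complex.continuous_re)
  have hev : f =ᶠ[nhds (2 + Complex.I)] 0 := by
    filter_upwards [hsector.mem_nhds (x := 2 + Complex.I) (by norm_num)] with c hc'
    exact eq_zero_of_im_lt_re hd hc h0 hc'.1 hc'.2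
  have heq : Set.EqOn f 0 {z : ℂ | 0 < z.im} :=
    (hd.analyticOnNhd hopen).eqOn_zero_of_preconnected_of_eventuallyEq_zero
      (convex_halfSpace_im_gt 0).isPreconnected (by simp) hev
  exact heq.of_subset_closure hc continuousOn_const (fun w (hw : 0 < w.im) ↦ hw.le)
    (Complex.closure_setOfPred_lt_im 0).ge hz

/-- Uniqueness part of van Winter's theorem: a Hardy class function on the upper
half-plane is uniquely determined by its boundary values on the positive real
half-axis. -/
theorem hardyAbove_unique_of_eq_on_nonneg (F G : ℂ → ℂ)
    (hF : HardyAbove 2 F) (hG : HardyAbove 2 G)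
    (h : ∀ x : ℝ, 0 ≤ x → F ↑x = G ↑x) :
    ∀ z : ℂ, 0 ≤ z.im → F z = G z := by
  intro z hz
  exact sub_eq_zero.mp <| eq_zero_of_eq_zero_on_nonneg (f := fun w ↦ F w - G w)
    (hF.1.sub hG.1) (hF.2.1.sub hG.2.1) (fun x hx ↦ sub_eq_zero.mpr (h x hx)) hz
end

section
/- Let H : ℝ → ℂ be a measurable function with ∫_ℝ (1 + e^{2πs}) |H(s)|² ds < ∞. For z in the open upper half-plane define F(z) = (2π)^{−1/2} ∫_ℝ H(s) · exp((−is − 1/2)·Log z) ds, where Log is the principal branch of the complex logarithm (whose imaginary part lies in (0, π) on the open upper half-plane). Then this integral converges absolutely for every z with Im z > 0, F is complex-differentiable on the open upper half-plane, and sup_{y>0} ∫_ℝ |F(x+iy)|² dx < ∞. (Existence part of van Winter's theorem via the Mellin transform.) -/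
open MeasureTheory Filter

open scoped FourierTransform ContDiff ENNReal Topology

/-- Plancherel's theorem for the Fourier integral of a function in `L¹ ∩ L²`. -/
theorem eLpNorm_fourier_eq {f : ℝ → ℂ} (hf : Integrable f) (hf2 : MemLp f 2) :
    eLpNorm (𝓕 f) 2 volume = eLpNorm f 2 volume := by
  set g : Lp ℂ 2 (volume : Measure ℝ) := hf2.toLp f with hg
  have hcont : Continuous (𝓕 f) :=
    VectorFourier.fourierIntegral_continuous Real.continuous_fourierChar
      (by exact continuous_inner) hf
  have key : ∀ᵐ x, (𝓕 g : Lp ℂ 2 (volume : Measure ℝ)) x = 𝓕 f x := by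
    apply ae_eq_of_integral_contDiff_smul_eq
    · exact (Lp.memLp _).locallyIntegrable one_le_two
    · exact hcont.locallyIntegrable
    · intro φ φ_smooth φ_cpt
      have h₁ : HasCompactSupport (Complex.ofRealCLM ∘ φ) := φ_cpt.comp_left rfl
      have h₂ : ContDiff ℝ ∞ (Complex.ofRealCLM ∘ φ) := by fun_prop
      set Φ : SchwartzMap ℝ ℂ := h₁.toSchwartzMap h₂ with hΦ
      have e := DFunLike.congr_fun (Lp.fourier_toTemperedDistribution_eq g) Φ
      rw [TemperedDistribution.fourier_apply, Lp.toTemperedDistribution_apply,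
        Lp.toTemperedDistribution_apply] at e
      calc ∫ x, φ x • (𝓕 g : Lp ℂ 2 (volume : Measure ℝ)) x
          = ∫ x, Φ x • (𝓕 g : Lp ℂ 2 (volume : Measure ℝ)) x := by simp [hΦ]
        _ = ∫ x, (𝓕 Φ) x • g x := e.symm
        _ = ∫ x, (𝓕 (Φ : ℝ → ℂ)) x • f x := by
          apply integral_congr_ae
          filter_upwards [hf2.coeFn_toLp] with x hx
          rw [hg, hx, SchwartzMap.fourier_coe]
        _ = ∫ x, Φ x • 𝓕 f x := by
          simpa using! (VectorFourier.integral_fourierIntegral_smul_eq_flip (L := innerₗ ℝ)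
            Real.continuous_fourierChar continuous_inner Φ.integrable hf)
        _ = ∫ x, φ x • 𝓕 f x := by simp [hΦ]
  have h1 : ‖(𝓕 g : Lp ℂ 2 (volume : Measure ℝ))‖ₑ = ‖g‖ₑ := by
    simp [enorm_eq_iff_norm_eq]
  rw [Lp.enorm_def, Lp.enorm_def, eLpNorm_congr_ae key, eLpNorm_congr_ae hf2.coeFn_toLp] at h1
  exact h1

theorem lintegral_eq_lintegral_comp_mul_left {a : ℝ} (ha : a ≠ 0) (g : ℝ → ℝ≥0∞) :
    ∫⁻ x, g x = ENNReal.ofReal |a| * ∫⁻ x, g (a * x) := by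
  have := lintegral_image_eq_lintegral_abs_deriv_mul (s := Set.univ) (f := fun x => a * x)
    (f' := fun _ => a) MeasurableSet.univ
    (fun x _ => by simpa only [id, mul_one] using
      ((hasDerivAt_id x).const_mul a).hasDerivWithinAt)
    (fun x _ y _ h => mul_left_cancel₀ ha h) g
  rw [Set.image_univ, (mul_left_surjective₀ ha).range_eq, Measure.restrict_univ,
    lintegral_const_mul' _ _ ENNReal.ofReal_ne_top] at this
  exact this

theorem lintegral_enorm_sq_integral_exp_mul {f : ℝ → ℂ} (hf : Integrable f) (hf2 : MemLp f 2) :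
    ∫⁻ x : ℝ, ‖∫ t : ℝ, Complex.exp (Complex.I * x * t) * f t‖ₑ ^ 2 =
      ENNReal.ofReal (2 * Real.pi) * ∫⁻ t, ‖f t‖ₑ ^ 2 := by
  have h := eLpNorm_fourier_eq hf hf2
  rw [eLpNorm_eq_lintegral_rpow_enorm_toReal two_ne_zero ENNReal.ofNat_ne_top,
    eLpNorm_eq_lintegral_rpow_enorm_toReal two_ne_zero ENNReal.ofNat_ne_top] at h
  have h := ENNReal.rpow_left_injective (x := 1 / (2 : ℝ≥0∞).toReal) (by norm_num) h
  simp only [ENNReal.toReal_ofNat, ENNReal.rpow_ofNat] at h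
  rw [lintegral_eq_lintegral_comp_mul_left (neg_ne_zero.2 Real.two_pi_pos.ne'), ← h, abs_neg,
    abs_of_pos Real.two_pi_pos]
  congr! 5 with x
  rw [Real.fourier_eq']
  congr! 4 with t
  simp
  ring

theorem Complex.norm_Gamma_half_add_I_mul_sq (s : ℝ) :
    ‖Complex.Gamma (1 / 2 + Complex.I * s)‖ ^ 2 = Real.pi / Real.cosh (Real.pi * s) := by
  have h := Complex.Gamma_mul_Gamma_one_sub (1 / 2 + Complex.I * s)
  have hc : 1 - (1 / 2 + Complex.I * s) = (starRingEnd ℂ) (1 / 2 + Complex.I * s) := by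
    apply Complex.ext <;> norm_num
  rw [hc, Complex.Gamma_conj, Complex.mul_conj, Complex.normSq_eq_norm_sq] at h
  have hs : Complex.sin (Real.pi * (1 / 2 + Complex.I * s)) = Real.cosh (Real.pi * s) := by
    rw [show (Real.pi : ℂ) * (1 / 2 + Complex.I * s)
        = (Real.pi * s : ℝ) * Complex.I + Real.pi / 2 by push_cast; ring,
      Complex.sin_add_pi_div_two, Complex.cos_mul_I, Complex.ofReal_cosh]
  rw [hs] at h
  exact_mod_cast h

/-- A parametric integral of functions holomorphic on a ball and dominated there by an integrable
function is complex-differentiable at the centre. -/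
theorem differentiableAt_integral_of_norm_le {α : Type*} [MeasurableSpace α] {μ : Measure α}
    {f : ℂ → α → ℂ} {bound : α → ℝ} {z₀ : ℂ} {R : ℝ} (hR : 0 < R)
    (hmeas : ∀ z ∈ Metric.ball z₀ R, AEStronglyMeasurable (f z) μ)
    (hmeas' : AEStronglyMeasurable (fun a => deriv (f · a) z₀) μ)
    (hdiff : ∀ᵐ a ∂μ, DifferentiableOn ℂ (f · a) (Metric.ball z₀ R))
    (hle : ∀ᵐ a ∂μ, ∀ z ∈ Metric.ball z₀ R, ‖f z a‖ ≤ bound a) (hbound : Integrable bound μ) :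
    DifferentiableAt ℂ (fun z => ∫ a, f z a ∂μ) z₀ := by
  have h0 : z₀ ∈ Metric.ball z₀ R := Metric.mem_ball_self hR
  refine (hasDerivAt_integral_of_dominated_loc_of_deriv_le (F := f)
    (F' := fun z a => deriv (f · a) z) (bound := fun a => bound a / (R / 4))
    (Metric.ball_mem_nhds z₀ (half_pos hR)) ?_ ?_ hmeas' ?_
    (hbound.div_const _) ?_).2.differentiableAt
  · filter_upwards [Metric.ball_mem_nhds z₀ hR] with z hz using hmeas z hz
  · exact hbound.mono' (hmeas z₀ h0) (hle.mono fun a ha => ha z₀ h0)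
  · filter_upwards [hdiff, hle] with a hd hl z hz
    have hsub : Metric.closedBall z (R / 4) ⊆ Metric.ball z₀ R := by
      apply Metric.closedBall_subset_ball'
      rw [Metric.mem_ball] at hz
      linarith
    refine Complex.norm_deriv_le_of_forall_mem_sphere_norm_le (by positivity) ?_ ?_
    · exact (hd.mono hsub).diffContOnCl_ball subset_rfl
    · exact fun w hw => hl w (hsub (Metric.sphere_subset_closedBall hw))
  · filter_upwards [hdiff] with a hd z hz
    exact (hd.differentiableAt (Metric.isOpen_ball.mem_nhds
      (Metric.ball_subset_ball (by linarith) hz))).hasDerivAt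

theorem integrableOn_rpow_mul_exp_neg_mul {p b : ℝ} (hp : -1 < p) (hb : 0 < b) :
    IntegrableOn (fun t : ℝ => t ^ p * Real.exp (-b * t)) (Set.Ioi 0) := by
  simpa using integrableOn_rpow_mul_exp_neg_mul_rpow (p := 1) hp zero_lt_one hb

theorem norm_cpow_mul_exp_neg_mul {a r : ℂ} {t : ℝ} (ht : 0 < t) :
    ‖(t : ℂ) ^ (a - 1) * Complex.exp (-(r * t))‖ =
      t ^ (a.re - 1) * Real.exp (-r.re * t) := by
  rw [norm_mul, Complex.norm_cpow_eq_rpow_re_of_pos ht, Complex.norm_exp]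
  simp

/-- The Gamma integral with a complex rate of positive real part. -/
theorem Complex.integral_cpow_mul_exp_neg_complex_mul_Ioi {a r : ℂ} (ha : 0 < a.re)
    (hr : 0 < r.re) :
    ∫ t in Set.Ioi (0 : ℝ), (t : ℂ) ^ (a - 1) * Complex.exp (-(r * t)) =
      Complex.exp (-(a * Complex.log r)) * Complex.Gamma a := by
  set U : Set ℂ := {z | 0 < z.re} with hU
  have hUo : IsOpen U := isOpen_lt continuous_const Complex.continuous_re
  have h1 : DifferentiableOn ℂ (fun r : ℂ => ∫ t in Set.Ioi (0 : ℝ),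
      (t : ℂ) ^ (a - 1) * Complex.exp (-(r * t))) U := by
    intro r₀ (hr₀ : 0 < r₀.re)
    apply DifferentiableAt.differentiableWithinAt
    apply differentiableAt_integral_of_norm_le (R := r₀.re / 2)
      (bound := fun t => t ^ (a.re - 1) * Real.exp (-(r₀.re / 2) * t)) (by positivity)
    · intro z hz
      apply Measurable.aestronglyMeasurable
      fun_prop
    · have : ∀ t : ℝ, deriv (fun z => (t : ℂ) ^ (a - 1) * Complex.exp (-(z * t))) r₀ =
          (t : ℂ) ^ (a - 1) * (Complex.exp (-(r₀ * t)) * -(1 * t)) := fun t =>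
        (((hasDerivAt_id r₀).mul_const (t : ℂ)).neg.cexp.const_mul _).deriv
      simp_rw [this]
      apply Measurable.aestronglyMeasurable
      fun_prop
    · exact .of_forall fun t => by fun_prop
    · filter_upwards [ae_restrict_mem measurableSet_Ioi] with t (ht : 0 < t) z hz
      rw [norm_cpow_mul_exp_neg_mul ht]
      have : r₀.re / 2 ≤ z.re := by
        have := (Complex.abs_re_le_norm (z - r₀)).trans_lt (mem_ball_iff_norm.1 hz)
        rw [Complex.sub_re, abs_lt] at this
        linarith
      gcongr
    · exact integrableOn_rpow_mul_exp_neg_mul (by linarith) (by positivity)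
  have h2 : DifferentiableOn ℂ (fun r : ℂ => Complex.exp (-(a * Complex.log r)) *
      Complex.Gamma a) U := by
    intro r₀ (hr₀ : 0 < r₀.re)
    have := (Complex.differentiableAt_log (Or.inl hr₀ : r₀ ∈ Complex.slitPlane))
    exact ((this.const_mul a).neg.cexp.mul_const _).differentiableWithinAt
  refine (h1.analyticOnNhd hUo).eqOn_of_preconnected_of_frequently_eq (h2.analyticOnNhd hUo)
    (convex_halfSpace_re_gt 0).isPreconnected (z₀ := 1) (by simp [hU]) ?_ hr
  have ht : Tendsto (fun x : ℝ => (x : ℂ)) (𝓝[≠] 1) (𝓝[≠] 1) := by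
    apply tendsto_nhdsWithin_of_tendsto_nhds_of_eventually_within
    · exact (Complex.continuous_ofReal.tendsto' 1 1 (by simp)).mono_left nhdsWithin_le_nhds
    · filter_upwards [self_mem_nhdsWithin] with x hx
      simpa using hx
  refine ht.frequently (Eventually.frequently ?_)
  filter_upwards [nhdsWithin_le_nhds (Ioi_mem_nhds zero_lt_one)] with x (hx : 0 < x)
  rw [Complex.integral_cpow_mul_exp_neg_mul_Ioi ha hx,
    Complex.cpow_def_of_ne_zero (by simp [hx.ne']),
    one_div, ← Complex.ofReal_inv, ← Complex.ofReal_log (by positivity), Real.log_inv,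
    ← Complex.ofReal_log hx.le]
  congr 2
  push_cast
  ring

theorem memLp_two_iff_lintegral_enorm_sq_lt_top {α : Type*} [MeasurableSpace α] {μ : Measure α}
    {f : α → ℂ} (hf : AEStronglyMeasurable f μ) :
    MemLp f 2 μ ↔ ∫⁻ a, ‖f a‖ₑ ^ 2 ∂μ < ⊤ := by
  have h := eLpNorm_lt_top_iff_lintegral_rpow_enorm_lt_top (f := f) (μ := μ) two_ne_zero
    ENNReal.ofNat_ne_top
  simp only [ENNReal.toReal_ofNat, ENNReal.rpow_ofNat] at h
  exact ⟨fun hm => h.1 hm.2, fun hl => ⟨hf, h.2 hl⟩⟩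

theorem lintegral_Ioi_eq_lintegral_exp (g : ℝ → ℝ≥0∞) :
    ∫⁻ t in Set.Ioi 0, g t = ∫⁻ u, ENNReal.ofReal (Real.exp u) * g (Real.exp u) := by
  have := lintegral_image_eq_lintegral_abs_deriv_mul (s := Set.univ) (f := Real.exp)
    (f' := Real.exp) MeasurableSet.univ
    (fun x _ => (Real.hasDerivAt_exp x).hasDerivWithinAt) Real.exp_injective.injOn g
  simpa [Set.image_univ, Real.range_exp] using this

/-- The function is the Fourier transform of `t ^ (-1/2) e^{-yt} ĝ(log t)` on the half-line, where
`ĝ` is the Fourier transform of `G`; the bound follows from Plancherel's theorem applied twice. -/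
theorem lintegral_enorm_sq_integral_mul_Gamma_le {G : ℝ → ℂ} (hG : Integrable G)
    (hG2 : MemLp G 2) {y : ℝ} (hy : 0 < y) :
    ∫⁻ x : ℝ, ‖∫ s : ℝ, G s * (Complex.exp (-((1 / 2 + Complex.I * s) *
        Complex.log (-Complex.I * (x + y * Complex.I)))) *
          Complex.Gamma (1 / 2 + Complex.I * s))‖ₑ ^ 2 ≤
      ENNReal.ofReal (2 * Real.pi) ^ 2 * ∫⁻ s, ‖G s‖ₑ ^ 2 := by
  set g : ℝ → ℂ := fun u => ∫ s : ℝ, Complex.exp (Complex.I * u * s) * G s with hg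
  have hg_cont : Continuous g := by
    refine continuous_of_dominated (bound := fun s => ‖G s‖) (fun u => ?_) (fun u => ?_)
      hG.norm (.of_forall fun s => by fun_prop)
    · exact (Measurable.aestronglyMeasurable (by fun_prop)).mul hG.1
    · refine .of_forall fun s => ?_
      rw [norm_mul, Complex.norm_exp]
      simp
  have hg_le : ∀ u, ‖g u‖ ≤ ∫ s, ‖G s‖ := fun u => by
    refine (norm_integral_le_integral_norm _).trans_eq ?_
    congr with s
    rw [norm_mul, Complex.norm_exp]
    simp
  set k : ℝ → ℂ := (Set.Ioi 0).indicator fun t =>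
    ((t ^ (-(1 / 2) : ℝ) * Real.exp (-y * t) : ℝ) : ℂ) * g (Real.log t) with hk
  have hk_meas : Measurable k := by
    refine Measurable.indicator ?_ measurableSet_Ioi
    exact (by fun_prop : Measurable fun t : ℝ =>
      ((t ^ (-(1 / 2) : ℝ) * Real.exp (-y * t) : ℝ) : ℂ)).mul
      (hg_cont.measurable.comp Real.measurable_log)
  have hweight := integrableOn_rpow_mul_exp_neg_mul (p := -(1 / 2)) (by norm_num) hy
  have hk_int : Integrable k := by
    rw [hk, integrable_indicator_iff measurableSet_Ioi]
    refine Integrable.mul_bdd (c := ∫ s, ‖G s‖) hweight.ofReal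
      (hg_cont.measurable.comp Real.measurable_log).aestronglyMeasurable
      (.of_forall fun t => hg_le _)
  have hk_le : ∫⁻ t, ‖k t‖ₑ ^ 2 ≤ ENNReal.ofReal (2 * Real.pi) * ∫⁻ s, ‖G s‖ₑ ^ 2 := by
    rw [← lintegral_enorm_sq_integral_exp_mul hG hG2]
    calc ∫⁻ t, ‖k t‖ₑ ^ 2
        = ∫⁻ t in Set.Ioi 0, ‖k t‖ₑ ^ 2 := by
          rw [← lintegral_indicator measurableSet_Ioi]
          congr with t
          by_cases ht : t ∈ Set.Ioi 0
          · rw [Set.indicator_of_mem ht]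
          · rw [Set.indicator_of_notMem ht, hk, Set.indicator_of_notMem ht]
            simp
      _ = ∫⁻ u, ENNReal.ofReal (Real.exp u) * ‖k (Real.exp u)‖ₑ ^ 2 :=
          lintegral_Ioi_eq_lintegral_exp _
      _ ≤ ∫⁻ u, ‖g u‖ₑ ^ 2 := by
          refine lintegral_mono fun u => ?_
          rw [hk, Set.indicator_of_mem (Set.mem_Ioi.2 (Real.exp_pos u)), Real.log_exp, enorm_mul,
            mul_pow, ← mul_assoc]
          refine mul_le_of_le_one_left' ?_
          rw [← ofReal_norm, Complex.norm_real, ← ENNReal.ofReal_pow (norm_nonneg _),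
            ← ENNReal.ofReal_mul (Real.exp_nonneg u), ENNReal.ofReal_le_one, Real.norm_eq_abs,
            sq_abs, ← Real.exp_mul, ← Real.exp_add, ← Real.exp_nat_mul, ← Real.exp_add,
            Real.exp_le_one_iff]
          have := mul_pos hy (Real.exp_pos u)
          push_cast
          linarith
  have hk2 : MemLp k 2 := by
    rw [memLp_two_iff_lintegral_enorm_sq_lt_top hk_meas.aestronglyMeasurable]
    refine hk_le.trans_lt (ENNReal.mul_lt_top ENNReal.ofReal_lt_top ?_)
    exact (memLp_two_iff_lintegral_enorm_sq_lt_top hG.1).1 hG2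
  have hswap : ∀ x : ℝ, ∫ s : ℝ, G s * (Complex.exp (-((1 / 2 + Complex.I * s) *
        Complex.log (-Complex.I * (x + y * Complex.I)))) *
          Complex.Gamma (1 / 2 + Complex.I * s)) =
      ∫ t : ℝ, Complex.exp (Complex.I * x * t) * k t := by
    intro x
    set r : ℂ := -Complex.I * (x + y * Complex.I) with hr
    have hr_re : r.re = y := by simp [hr]
    have hre : ∀ s : ℝ, (1 / 2 + Complex.I * s : ℂ).re = 1 / 2 := fun s => by simp
    calc _ = ∫ s : ℝ, ∫ t in Set.Ioi (0 : ℝ), G s *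
            ((t : ℂ) ^ ((1 / 2 + Complex.I * s : ℂ) - 1) * Complex.exp (-(r * t))) := by
          congr with s
          rw [integral_const_mul, Complex.integral_cpow_mul_exp_neg_complex_mul_Ioi
            (by rw [hre]; norm_num) (by rwa [hr_re])]
      _ = ∫ t in Set.Ioi (0 : ℝ), ∫ s : ℝ, G s *
            ((t : ℂ) ^ ((1 / 2 + Complex.I * s : ℂ) - 1) * Complex.exp (-(r * t))) := by
          apply integral_integral_swap
          refine (hG.norm.mul_prod hweight).mono' ?_ ?_
          · exact hG.1.comp_fst.mul (Measurable.aestronglyMeasurable (by fun_prop))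
          · have : ∀ᵐ p : ℝ × ℝ ∂(volume.prod (volume.restrict (Set.Ioi 0))), 0 < p.2 :=
              Measure.quasiMeasurePreserving_snd.ae (ae_restrict_mem measurableSet_Ioi)
            filter_upwards [this] with p hp
            rw [Function.uncurry_def, norm_mul, norm_cpow_mul_exp_neg_mul hp, hre, hr_re]
            norm_num
      _ = ∫ t in Set.Ioi (0 : ℝ), Complex.exp (Complex.I * x * t) * k t := by
          refine setIntegral_congr_fun measurableSet_Ioi fun t (ht : 0 < t) => ?_
          simp only [hk]
          rw [Set.indicator_of_mem (Set.mem_Ioi.2 ht), hg, ← integral_const_mul,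
            ← integral_const_mul]
          congr with s
          rw [Complex.cpow_def_of_ne_zero (by exact_mod_cast ht.ne'), ← Complex.ofReal_log ht.le,
            Real.rpow_def_of_pos ht, ← Real.exp_add, Complex.ofReal_exp, ← Complex.exp_add,
            mul_comm (G s), ← mul_assoc, ← mul_assoc, ← Complex.exp_add, ← Complex.exp_add]
          congr 2
          push_cast
          rw [hr]
          linear_combination ((y : ℂ) * t) * Complex.I_sq
      _ = _ := by
          rw [← integral_indicator measurableSet_Ioi]
          congr with t
          by_cases ht : t ∈ Set.Ioi 0
          · rw [Set.indicator_of_mem ht]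
          · rw [Set.indicator_of_notMem ht, hk, Set.indicator_of_notMem ht, mul_zero]
  simp_rw [hswap]
  rw [lintegral_enorm_sq_integral_exp_mul hk_int hk2, sq, mul_assoc]
  gcongr

theorem integrable_exp_div_one_add_exp {a b : ℝ} (ha : 0 < a) (hab : a < b) :
    Integrable fun s : ℝ => Real.exp (a * s) / (1 + Real.exp (b * s)) := by
  have hmeas : Measurable fun s : ℝ => Real.exp (a * s) / (1 + Real.exp (b * s)) := by fun_prop
  rw [← integrableOn_univ, ← Set.Iic_union_Ioi (a := (0 : ℝ))]
  refine IntegrableOn.union ?_ ?_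
  · refine (integrableOn_exp_mul_Iic ha 0).mono' hmeas.aestronglyMeasurable (.of_forall fun s => ?_)
    rw [Real.norm_of_nonneg (by positivity)]
    exact div_le_self (Real.exp_nonneg _) (by linarith [Real.exp_nonneg (b * s)])
  · refine (integrableOn_exp_mul_Ioi (sub_neg.2 hab) 0).mono' hmeas.aestronglyMeasurable
      (.of_forall fun s => ?_)
    rw [Real.norm_of_nonneg (by positivity), div_le_iff₀ (by positivity), mul_add, ← Real.exp_add,
      sub_mul, sub_add_cancel]
    linarith [Real.exp_nonneg (a * s - b * s)]

section VanWinter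

variable {H : ℝ → ℂ}

theorem integrable_norm_mul_exp (hHm : Measurable H)
    (hH : Integrable (fun s : ℝ => (1 + Real.exp (2 * Real.pi * s)) * ‖H s‖ ^ 2))
    {θ : ℝ} (hθ : 0 < θ) (hθπ : θ < Real.pi) :
    Integrable fun s : ℝ => ‖H s‖ * Real.exp (θ * s) := by
  have h2 := integrable_exp_div_one_add_exp (a := 2 * θ) (b := 2 * Real.pi) (by linarith)
    (by linarith)
  refine (hH.add h2).mono' (by fun_prop) (.of_forall fun s => ?_)
  set w := 1 + Real.exp (2 * Real.pi * s)
  have hw : 0 < w := by positivity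
  have he : Real.exp (2 * θ * s) = Real.exp (θ * s) ^ 2 := by
    rw [← Real.exp_nat_mul]
    congr 1
    push_cast
    ring
  rw [Real.norm_of_nonneg (by positivity), Pi.add_apply, he, ← sub_nonneg]
  have : 0 ≤ ((w * ‖H s‖ - Real.exp (θ * s)) ^ 2 + w * (‖H s‖ * Real.exp (θ * s))) / w := by
    positivity
  convert this using 1
  field_simp
  ring

theorem norm_mul_cexp_eq (s : ℝ) (w : ℂ) :
    ‖H s * Complex.exp ((-Complex.I * s - 1 / 2) * w)‖ =
      Real.exp (-w.re / 2) * (‖H s‖ * Real.exp (w.im * s)) := by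
  rw [norm_mul, Complex.norm_exp, mul_left_comm, ← Real.exp_add]
  congr 2
  simp
  ring

theorem integrable_mul_cexp (hHm : Measurable H)
    (hH : Integrable (fun s : ℝ => (1 + Real.exp (2 * Real.pi * s)) * ‖H s‖ ^ 2))
    {w : ℂ} (hw : 0 < w.im) (hwπ : w.im < Real.pi) :
    Integrable fun s : ℝ => H s * Complex.exp ((-Complex.I * s - 1 / 2) * w) := by
  refine ((integrable_norm_mul_exp hHm hH hw hwπ).const_mul (Real.exp (-w.re / 2))).mono'
    (Measurable.aestronglyMeasurable (by fun_prop)) (.of_forall fun s => ?_)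
  rw [norm_mul_cexp_eq]

theorem differentiableAt_integral_mul_cexp (hHm : Measurable H)
    (hH : Integrable (fun s : ℝ => (1 + Real.exp (2 * Real.pi * s)) * ‖H s‖ ^ 2))
    {w₀ : ℂ} (hw : 0 < w₀.im) (hwπ : w₀.im < Real.pi) :
    DifferentiableAt ℂ
      (fun w => ∫ s : ℝ, H s * Complex.exp ((-Complex.I * s - 1 / 2) * w)) w₀ := by
  obtain ⟨R, hR, hR'⟩ : ∃ R, 0 < R ∧ R < min w₀.im (Real.pi - w₀.im) :=
    exists_between (lt_min hw (sub_pos.2 hwπ))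
  rw [lt_min_iff] at hR'
  apply differentiableAt_integral_of_norm_le hR (bound := fun s => Real.exp (-(w₀.re - R) / 2) *
    (‖H s‖ * Real.exp ((w₀.im - R) * s) + ‖H s‖ * Real.exp ((w₀.im + R) * s)))
  · exact fun w _ => Measurable.aestronglyMeasurable (by fun_prop)
  · have : ∀ s : ℝ, deriv (fun w => H s * Complex.exp ((-Complex.I * s - 1 / 2) * w)) w₀ =
        H s * (Complex.exp ((-Complex.I * s - 1 / 2) * w₀) * ((-Complex.I * s - 1 / 2) * 1)) :=
      fun s => (((hasDerivAt_id w₀).const_mul (-Complex.I * s - 1 / 2)).cexp.const_mul _).deriv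
    simp_rw [this]
    exact Measurable.aestronglyMeasurable (by fun_prop)
  · exact .of_forall fun s => by fun_prop
  · refine .of_forall fun s w hw => ?_
    rw [mem_ball_iff_norm] at hw
    have hre := (Complex.abs_re_le_norm (w - w₀)).trans_lt hw
    have him := (Complex.abs_im_le_norm (w - w₀)).trans_lt hw
    rw [Complex.sub_re, abs_lt] at hre
    rw [Complex.sub_im, abs_lt] at him
    rw [norm_mul_cexp_eq, ← mul_add]
    have : Real.exp (w.im * s) ≤
        Real.exp ((w₀.im - R) * s) + Real.exp ((w₀.im + R) * s) := by
      rcases le_total 0 s with hs | hs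
      · have : Real.exp (w.im * s) ≤ Real.exp ((w₀.im + R) * s) :=
          Real.exp_le_exp.2 (mul_le_mul_of_nonneg_right (by linarith) hs)
        linarith [Real.exp_nonneg ((w₀.im - R) * s)]
      · have : Real.exp (w.im * s) ≤ Real.exp ((w₀.im - R) * s) :=
          Real.exp_le_exp.2 (mul_le_mul_of_nonpos_right (by linarith) hs)
        linarith [Real.exp_nonneg ((w₀.im + R) * s)]
    gcongr
    linarith
  · exact ((integrable_norm_mul_exp hHm hH (by linarith) (by linarith)).add
      (integrable_norm_mul_exp hHm hH (by linarith) (by linarith))).const_mul _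

theorem Complex.log_im_mem_Ioo_of_im_pos {z : ℂ} (hz : 0 < z.im) :
    (Complex.log z).im ∈ Set.Ioo 0 Real.pi := by
  rw [Complex.log_im]
  refine ⟨(Complex.arg_nonneg_iff.2 hz.le).lt_of_ne fun h => ?_,
    (Complex.arg_le_pi z).lt_of_ne fun h => ?_⟩
  · exact hz.ne' (Complex.arg_eq_zero_iff.1 h.symm).2
  · exact hz.ne' (Complex.arg_eq_pi_iff.1 h).2

theorem Complex.log_neg_I_mul_of_im_pos {z : ℂ} (hz : 0 < z.im) :
    Complex.log (-Complex.I * z) = Complex.log z - Real.pi / 2 * Complex.I := by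
  have h := Complex.log_im_mem_Ioo_of_im_pos hz
  rw [Complex.log_im] at h
  have hz0 : z ≠ 0 := fun h0 => by simp [h0] at hz
  rw [(Complex.log_mul_eq_add_log_iff (by simp) hz0).2, Complex.log_neg_I]
  · ring
  · rw [Complex.arg_neg_I]
    constructor <;> linarith [h.1, h.2, Real.pi_pos]

theorem lintegral_enorm_sq_gammaWeighted_eq (H : ℝ → ℂ) :
    ENNReal.ofReal (2 * Real.pi) * ∫⁻ s : ℝ, ‖H s * (Real.exp (Real.pi / 2 * s) : ℂ) /
        Complex.Gamma (1 / 2 + Complex.I * s)‖ₑ ^ 2 =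
      ∫⁻ s : ℝ, ENNReal.ofReal ((1 + Real.exp (2 * Real.pi * s)) * ‖H s‖ ^ 2) := by
  rw [← lintegral_const_mul' _ _ ENNReal.ofReal_ne_top]
  congr with s
  rw [← ofReal_norm, ← ENNReal.ofReal_pow (norm_nonneg _), ← ENNReal.ofReal_mul Real.two_pi_pos.le,
    norm_div, div_pow, Complex.norm_Gamma_half_add_I_mul_sq, norm_mul, Complex.norm_real,
    Real.norm_of_nonneg (Real.exp_nonneg _), mul_pow, ← Real.exp_nat_mul, Real.cosh_eq]
  congr 1
  have e1 : Real.exp (2 * Real.pi * s) = Real.exp (Real.pi * s) * Real.exp (Real.pi * s) := by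
    rw [← Real.exp_add]; ring_nf
  have e2 : Real.exp (-(Real.pi * s)) = (Real.exp (Real.pi * s))⁻¹ := Real.exp_neg _
  have e3 : (2 : ℕ) * (Real.pi / 2 * s) = Real.pi * s := by push_cast; ring
  rw [e1, e2, e3]
  have := (Real.exp_pos (Real.pi * s)).ne'
  have := Real.pi_pos.ne'
  field_simp
  ring

theorem mul_cexp_eq_gammaWeighted (s : ℝ) {z : ℂ} (hz : 0 < z.im) :
    H s * Complex.exp ((-Complex.I * s - 1 / 2) * Complex.log z) =
      Complex.exp (-(Real.pi / 4 * Complex.I)) *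
        (H s * (Real.exp (Real.pi / 2 * s) : ℂ) / Complex.Gamma (1 / 2 + Complex.I * s) *
          (Complex.exp (-((1 / 2 + Complex.I * s) * Complex.log (-Complex.I * z))) *
            Complex.Gamma (1 / 2 + Complex.I * s))) := by
  have hΓ : Complex.Gamma (1 / 2 + Complex.I * s) ≠ 0 :=
    Complex.Gamma_ne_zero_of_re_pos (by simp)
  have : Complex.exp ((-Complex.I * s - 1 / 2) * Complex.log z) =
      Complex.exp (-(Real.pi / 4 * Complex.I)) * (Real.exp (Real.pi / 2 * s) : ℂ) *
        Complex.exp (-((1 / 2 + Complex.I * s) * Complex.log (-Complex.I * z))) := by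
    rw [Complex.log_neg_I_mul_of_im_pos hz, Complex.ofReal_exp, ← Complex.exp_add,
      ← Complex.exp_add]
    congr 1
    push_cast
    linear_combination (-(Real.pi : ℂ) / 2 * s) * Complex.I_sq
  rw [this, mul_comm (Complex.exp (-(_ * _))) (Complex.Gamma _), ← mul_assoc (_ / _),
    div_mul_cancel₀ _ hΓ]
  ring

/-- The uniform `L²` bound on horizontal lines, obtained by truncating `H` and Fatou's lemma. -/
theorem lintegral_enorm_sq_integral_mul_cexp_le (hHm : Measurable H)
    (hH : Integrable (fun s : ℝ => (1 + Real.exp (2 * Real.pi * s)) * ‖H s‖ ^ 2))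
    {y : ℝ} (hy : 0 < y) :
    ∫⁻ x : ℝ, ‖∫ s : ℝ, H s * Complex.exp ((-Complex.I * s - 1 / 2) *
        Complex.log (x + y * Complex.I))‖ₑ ^ 2 ≤
      ENNReal.ofReal (2 * Real.pi * ∫ s : ℝ, (1 + Real.exp (2 * Real.pi * s)) * ‖H s‖ ^ 2) := by
  have him : ∀ x : ℝ, 0 < (x + y * Complex.I : ℂ).im := fun x => by simpa using hy
  set G : ℝ → ℂ := fun s => H s * (Real.exp (Real.pi / 2 * s) : ℂ) /
    Complex.Gamma (1 / 2 + Complex.I * s) with hGdef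
  have hΓ : Continuous fun s : ℝ => Complex.Gamma (1 / 2 + Complex.I * s) := by
    refine continuous_iff_continuousAt.2 fun s => ?_
    refine ContinuousAt.comp (f := fun s : ℝ => 1 / 2 + Complex.I * (s : ℂ))
      (Complex.differentiableAt_Gamma _ fun m h => ?_).continuousAt (by fun_prop)
    have := congrArg Complex.re h
    simp at this
    have hm : (0 : ℝ) ≤ m := m.cast_nonneg
    linarith
  have hGm : Measurable G := (hHm.mul (by fun_prop)).div hΓ.measurable
  have hnorm : ENNReal.ofReal (2 * Real.pi) * ∫⁻ s, ‖G s‖ₑ ^ 2 =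
      ENNReal.ofReal (∫ s : ℝ, (1 + Real.exp (2 * Real.pi * s)) * ‖H s‖ ^ 2) := by
    rw [lintegral_enorm_sq_gammaWeighted_eq,
      ofReal_integral_eq_lintegral_ofReal hH (.of_forall fun s => by positivity)]
  have hG2 : MemLp G 2 := by
    rw [memLp_two_iff_lintegral_enorm_sq_lt_top hGm.aestronglyMeasurable]
    refine ENNReal.lt_top_of_mul_ne_top_right (hnorm ▸ ENNReal.ofReal_ne_top) ?_
    simpa using Real.pi_pos
  set I : ℕ → Set ℝ := fun n => Set.Icc (-(n : ℝ)) n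
  have hI : ∀ n, MeasurableSet (I n) := fun n => measurableSet_Icc
  have hGn2 : ∀ n, MemLp ((I n).indicator G) 2 := fun n => hG2.indicator (hI n)
  have hGn1 : ∀ n, Integrable ((I n).indicator G) := fun n => by
    rw [integrable_indicator_iff (hI n)]
    have : IsFiniteMeasure (volume.restrict (I n)) := ⟨by simp [I]⟩
    exact (hG2.restrict (I n)).integrable one_le_two
  set Φ : ℕ → ℝ → ℂ := fun n x => ∫ s : ℝ, (I n).indicator H s *
    Complex.exp ((-Complex.I * s - 1 / 2) * Complex.log (x + y * Complex.I)) with hΦ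
  have hΦm : ∀ n, Measurable (Φ n) := fun n => by
    have : Measurable ((I n).indicator H) := hHm.indicator (hI n)
    refine (StronglyMeasurable.integral_prod_right (f := fun (x : ℝ) (s : ℝ) =>
      (I n).indicator H s * Complex.exp ((-Complex.I * s - 1 / 2) *
        Complex.log (x + y * Complex.I))) ?_).measurable
    exact Measurable.stronglyMeasurable (by fun_prop)
  have hlim : ∀ x : ℝ, Tendsto (fun n => Φ n x) atTop (𝓝 (∫ s : ℝ, H s *
      Complex.exp ((-Complex.I * s - 1 / 2) * Complex.log (x + y * Complex.I)))) := fun x => by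
    have hlog := Complex.log_im_mem_Ioo_of_im_pos (him x)
    refine tendsto_integral_of_dominated_convergence _ (fun n => ?_)
      (integrable_mul_cexp hHm hH hlog.1 hlog.2).norm (fun n => .of_forall fun s => ?_)
      (.of_forall fun s => ?_)
    · have : Measurable ((I n).indicator H) := hHm.indicator (hI n)
      exact Measurable.aestronglyMeasurable (by fun_prop)
    · rw [norm_mul, norm_mul]
      gcongr
      exact norm_indicator_le_norm_self _ _
    · refine tendsto_const_nhds.congr' ?_
      filter_upwards [eventually_ge_atTop ⌈|s|⌉₊] with n hn
      rw [Set.indicator_of_mem]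
      exact abs_le.1 (Nat.ceil_le.1 hn)
  have hle : ∀ n, ∫⁻ x, ‖Φ n x‖ₑ ^ 2 ≤
      ENNReal.ofReal (2 * Real.pi * ∫ s : ℝ, (1 + Real.exp (2 * Real.pi * s)) * ‖H s‖ ^ 2) := by
    intro n
    have hind : ∀ s : ℝ, (I n).indicator H s * (Real.exp (Real.pi / 2 * s) : ℂ) /
        Complex.Gamma (1 / 2 + Complex.I * s) = (I n).indicator G s := fun s => by
      by_cases hs : s ∈ I n <;> simp [hs, hGdef]
    calc ∫⁻ x, ‖Φ n x‖ₑ ^ 2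
        = ∫⁻ x : ℝ, ‖∫ s : ℝ, (I n).indicator G s * (Complex.exp (-((1 / 2 + Complex.I * s) *
            Complex.log (-Complex.I * (x + y * Complex.I)))) *
              Complex.Gamma (1 / 2 + Complex.I * s))‖ₑ ^ 2 := by
          congr with x
          simp only [hΦ]
          simp_rw [mul_cexp_eq_gammaWeighted _ (him x), hind]
          rw [integral_const_mul, enorm_mul]
          have : ‖Complex.exp (-(Real.pi / 4 * Complex.I))‖ₑ = 1 := by
            rw [← ofReal_norm, Complex.norm_exp]
            simp
          rw [this, one_mul]
      _ ≤ ENNReal.ofReal (2 * Real.pi) ^ 2 * ∫⁻ s, ‖(I n).indicator G s‖ₑ ^ 2 :=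
          lintegral_enorm_sq_integral_mul_Gamma_le (hGn1 n) (hGn2 n) hy
      _ ≤ ENNReal.ofReal (2 * Real.pi) ^ 2 * ∫⁻ s, ‖G s‖ₑ ^ 2 := by
          gcongr with s
          exact enorm_indicator_le_enorm_self _ _
      _ = _ := by
          rw [sq, mul_assoc, hnorm, ← ENNReal.ofReal_mul Real.two_pi_pos.le]
  calc _ = ∫⁻ x, liminf (fun n => ‖Φ n x‖ₑ ^ 2) atTop := by
        congr with x
        exact (((ENNReal.continuous_pow 2).tendsto _).comp (hlim x).enorm).liminf_eq.symm
    _ ≤ liminf (fun n => ∫⁻ x, ‖Φ n x‖ₑ ^ 2) atTop :=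
        lintegral_liminf_le fun n => (hΦm n).enorm.pow_const 2
    _ ≤ _ := liminf_le_of_le (by isBoundedDefault) fun b hb => by
        obtain ⟨n, hn⟩ := hb.exists
        exact hn.trans (hle n)

end VanWinter



/-- Existence part of van Winter's theorem via the Mellin transform: if
`∫ (1 + e^{2πs}) |H(s)|² ds < ∞`, then
`F(z) = (2π)^{-1/2} ∫ H(s) exp((-is - 1/2) Log z) ds` converges absolutely for
every `z` in the open upper half-plane, is complex-differentiable there, and
satisfies the order-2 Hardy bound `sup_{y>0} ∫ |F(x+iy)|² dx < ∞`. -/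
theorem vanWinter_existence (H : ℝ → ℂ) (hHm : Measurable H)
    (hH : Integrable (fun s : ℝ => (1 + Real.exp (2 * Real.pi * s)) * ‖H s‖ ^ 2))
    (F : ℂ → ℂ)
    (hF : ∀ z : ℂ, 0 < z.im →
      F z = (↑((2 * Real.pi) ^ (-(1 : ℝ) / 2)) : ℂ) *
        ∫ s : ℝ, H s * Complex.exp ((-Complex.I * ↑s - 1 / 2) * Complex.log z)) :
    (∀ z : ℂ, 0 < z.im →
      Integrable (fun s : ℝ =>
        H s * Complex.exp ((-Complex.I * ↑s - 1 / 2) * Complex.log z))) ∧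
    DifferentiableOn ℂ F {z : ℂ | 0 < z.im} ∧
    ∃ M : ℝ, ∀ y : ℝ, 0 < y →
      Integrable (fun x : ℝ => ‖F (↑x + ↑y * Complex.I)‖ ^ 2) ∧
      ∫ x : ℝ, ‖F (↑x + ↑y * Complex.I)‖ ^ 2 ≤ M := by
  have hlog := fun (z : ℂ) (hz : 0 < z.im) => Complex.log_im_mem_Ioo_of_im_pos hz
  have hdiff : DifferentiableOn ℂ F {z : ℂ | 0 < z.im} := by
    refine DifferentiableOn.congr (fun z (hz : 0 < z.im) => ?_) fun z hz => hF z hz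
    refine (DifferentiableAt.const_mul ?_ _).differentiableWithinAt
    exact DifferentiableAt.comp
      (g := fun w => ∫ s : ℝ, H s * Complex.exp ((-Complex.I * s - 1 / 2) * w)) z
      (differentiableAt_integral_mul_cexp hHm hH (hlog z hz).1 (hlog z hz).2)
      (Complex.differentiableAt_log (Or.inr hz.ne'))
  refine ⟨fun z hz => integrable_mul_cexp hHm hH (hlog z hz).1 (hlog z hz).2, hdiff,
    ∫ s : ℝ, (1 + Real.exp (2 * Real.pi * s)) * ‖H s‖ ^ 2, fun y hy => ?_⟩
  have him : ∀ x : ℝ, 0 < (x + y * Complex.I : ℂ).im := fun x => by simpa using hy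
  have hcont : Continuous fun x : ℝ => F (x + y * Complex.I) :=
    hdiff.continuousOn.comp_continuous (by fun_prop) him
  have hle : ∫⁻ x : ℝ, ENNReal.ofReal (‖F (x + y * Complex.I)‖ ^ 2) ≤
      ENNReal.ofReal (∫ s : ℝ, (1 + Real.exp (2 * Real.pi * s)) * ‖H s‖ ^ 2) := by
    have hc : ‖(((2 * Real.pi) ^ (-(1 : ℝ) / 2) : ℝ) : ℂ)‖ₑ ^ 2 =
        ENNReal.ofReal (2 * Real.pi)⁻¹ := by
      rw [← ofReal_norm, Complex.norm_real, ← ENNReal.ofReal_pow (norm_nonneg _),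
        Real.norm_of_nonneg (by positivity), ← Real.rpow_mul_natCast Real.two_pi_pos.le,
        ← Real.rpow_neg_one]
      norm_num
    calc ∫⁻ x : ℝ, ENNReal.ofReal (‖F (x + y * Complex.I)‖ ^ 2)
        = ENNReal.ofReal (2 * Real.pi)⁻¹ * ∫⁻ x : ℝ, ‖∫ s : ℝ, H s *
            Complex.exp ((-Complex.I * s - 1 / 2) * Complex.log (x + y * Complex.I))‖ₑ ^ 2 := by
          rw [← lintegral_const_mul' _ _ ENNReal.ofReal_ne_top]
          congr with x
          rw [ENNReal.ofReal_pow (norm_nonneg _), ofReal_norm, hF _ (him x), enorm_mul, mul_pow, hc]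
      _ ≤ _ := by
          grw [lintegral_enorm_sq_integral_mul_cexp_le hHm hH hy]
          rw [← ENNReal.ofReal_mul (by positivity), inv_mul_cancel_left₀ Real.two_pi_pos.ne']
  have hint : Integrable fun x : ℝ => ‖F (x + y * Complex.I)‖ ^ 2 := by
    refine ⟨(hcont.norm.pow 2).aestronglyMeasurable, ?_⟩
    rw [hasFiniteIntegral_iff_ofReal (.of_forall fun x => by positivity)]
    exact hle.trans_lt ENNReal.ofReal_lt_top
  refine ⟨hint, ?_⟩
  rwa [← ofReal_integral_eq_lintegral_ofReal hint (.of_forall fun x => by positivity),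
    ENNReal.ofReal_le_ofReal_iff (integral_nonneg fun s => by positivity)] at hle
end
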